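/- Let F ⊂ ℝⁿ be a compact convex set of positive volume, let G ⊆ ℂ be an open domain, and let f : F × G → ℂ be such that for each fixed x ∈ F the function z ↦ f(x,z) is analytic and not identically zero on G, and for each fixed z ∈ G the function x ↦ f(x,z) is (the restriction of) a polynomial of degree at most d on ℝⁿ. For x ∈ F let ν_x = Σ_{w : f(x,w)=0} δ_w be the counting measure of zeroes of f(x,·) in G (zeroes counted with multiplicity), and let ν be the average measure ν(U) = (1/Vol(F)) ∫_F ν_x(U) dx. Then for every ψ ∈ C_0^∞(G) and every λ > 0, Vol{x ∈ F : |∫_G ψ dν_x − ∫_G ψ dν| ≥ λ} / Vol(F) ≤ 8e² · exp(−2πλ / (d · ‖Δψ‖_{L¹(G)})), where Δψ is the Laplacian of ψ and ‖Δψ‖_{L¹(G)} = ∫_G |Δψ| dm₂ with m₂ the planar Lebesgue (area) measure. -/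

import Mathlib

open MeasureTheory

/-- The Laplacian of a function `ψ : ℂ → ℝ`, as the sum of the second directional
derivatives in the directions `1` and `i`. -/
noncomputable def planarLaplacian (ψ : ℂ → ℝ) (z : ℂ) : ℝ :=
  fderiv ℝ (fun w => fderiv ℝ ψ w 1) z 1 +
    fderiv ℝ (fun w => fderiv ℝ ψ w Complex.I) z Complex.I

theorem exists_separated_points {δ : ℝ} (hδ : 0 < δ) (d : ℕ) :
    ∀ E : Set ℝ, IsCompact E → ENNReal.ofReal (d * δ) < volume E →
      ∃ x : ℕ → ℝ, (∀ i ≤ d, x i ∈ E) ∧ ∀ i < d, x i + δ ≤ x (i + 1) := by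
  induction d with
  | zero =>
    intro E _ hE
    have hne : E.Nonempty := by
      rw [Set.nonempty_iff_ne_empty]
      rintro rfl
      simp at hE
    obtain ⟨y, hy⟩ := hne
    exact ⟨fun _ => y, fun _ _ => hy, fun i hi => by omega⟩
  | succ d ih =>
    intro E hEc hE
    have hne : E.Nonempty := by
      rw [Set.nonempty_iff_ne_empty]
      rintro rfl
      simp at hE
    obtain ⟨m, hm, hmax⟩ := hEc.exists_isMaxOn hne continuousOn_id
    have hsub : E ⊆ (E ∩ Set.Iic (m - δ)) ∪ Set.Icc (m - δ) m := by
      intro y hy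
      by_cases h : y ≤ m - δ
      · exact Or.inl ⟨hy, h⟩
      · exact Or.inr ⟨(not_le.1 h).le, hmax hy⟩
    have hE' : ENNReal.ofReal (d * δ) < volume (E ∩ Set.Iic (m - δ)) := by
      by_contra hcon
      have h1 := (measure_mono hsub).trans (measure_union_le (μ := volume) _ _)
      rw [Real.volume_Icc] at h1
      have h2 := h1.trans (add_le_add_left (not_lt.1 hcon) _)
      rw [← ENNReal.ofReal_add (by positivity) (by linarith)] at h2
      refine absurd hE (not_lt.2 (h2.trans (ENNReal.ofReal_le_ofReal ?_)))
      push_cast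
      linarith
    obtain ⟨x, hx, hsep⟩ := ih _ (hEc.inter_right isClosed_Iic) hE'
    refine ⟨fun i => if i ≤ d then x i else m, ?_, ?_⟩
    · intro i _
      by_cases h : i ≤ d
      · simpa [h] using (hx i h).1
      · simpa [h] using hm
    · intro i hi
      rcases (Nat.lt_succ_iff.1 hi).lt_or_eq with h | rfl
      · simpa [h.le, Nat.succ_le_of_lt h] using hsep i h
      · have : x i ≤ m - δ := (hx i le_rfl).2
        simp
        linarith

theorem mul_sub_le_sub_of_separated {δ : ℝ} {x : ℕ → ℝ} {d : ℕ}
    (hsep : ∀ i < d, x i + δ ≤ x (i + 1)) {i j : ℕ} (hij : i ≤ j) (hj : j ≤ d) :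
    ((j : ℝ) - i) * δ ≤ x j - x i := by
  induction j, hij using Nat.le_induction with
  | base => simp
  | succ j hij ih =>
    have := ih (by omega)
    have := hsep j (by omega)
    push_cast
    linarith

theorem prod_abs_sub_range_erase {d j : ℕ} (hj : j ≤ d) :
    ∏ i ∈ (Finset.range (d + 1)).erase j, |(j : ℝ) - i| = j.factorial * (d - j).factorial := by
  have hsplit : (Finset.range (d + 1)).erase j =
      Finset.range j ∪ Finset.Ico (j + 1) (d + 1) := by
    ext i
    simp only [Finset.mem_erase, Finset.mem_range, Finset.mem_union, Finset.mem_Ico]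
    omega
  have hdisj : Disjoint (Finset.range j) (Finset.Ico (j + 1) (d + 1)) := by
    rw [Finset.disjoint_left]
    intro i
    simp only [Finset.mem_range, Finset.mem_Ico]
    omega
  rw [hsplit, Finset.prod_union hdisj]
  congr 1
  · rw [← Finset.prod_range_add_one_eq_factorial, ← Finset.prod_range_reflect]
    push_cast
    refine Finset.prod_congr rfl fun i hi => ?_
    have hi' : i < j := Finset.mem_range.1 hi
    rw [Nat.sub_sub, Nat.cast_sub (by omega), abs_of_nonneg]
    · push_cast
      ring
    · push_cast
      have : (1 : ℝ) + i ≤ j := by exact_mod_cast (by omega : 1 + i ≤ j)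
      linarith
  · rw [Finset.prod_Ico_eq_prod_range, ← Finset.prod_range_add_one_eq_factorial,
      show d + 1 - (j + 1) = d - j by omega]
    push_cast
    refine Finset.prod_congr rfl fun i _ => ?_
    rw [abs_sub_comm, abs_of_nonneg] <;> linarith [(Nat.cast_nonneg i : (0 : ℝ) ≤ i)]

theorem sum_inv_factorial_mul_factorial (d : ℕ) :
    ∑ j ∈ Finset.range (d + 1), ((j.factorial : ℝ) * (d - j).factorial)⁻¹ =
      2 ^ d / d.factorial := by
  have h := (Nat.sum_range_choose d)
  have h' : ∑ j ∈ Finset.range (d + 1), (d.choose j : ℝ) = 2 ^ d := by exact_mod_cast h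
  rw [← h', Finset.sum_div]
  refine Finset.sum_congr rfl fun j hj => ?_
  rw [Nat.cast_choose ℝ (Nat.lt_succ_iff.1 (Finset.mem_range.1 hj))]
  field_simp

/-- A Remez-type inequality with constant `2 * e`. -/
theorem volume_sublevel_polynomial_le {d : ℕ} (hd : 1 ≤ d) (P : Polynomial ℂ)
    (hP : P.natDegree ≤ d) {a b v ε : ℝ} (hv : v ∈ Set.Icc a b) (hε : 0 ≤ ε)
    (hPv : P.eval (v : ℂ) ≠ 0) :
    volume {s ∈ Set.Icc a b | ‖P.eval (s : ℂ)‖ ≤ ε ^ d * ‖P.eval (v : ℂ)‖} ≤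
      ENNReal.ofReal (2 * Real.exp 1 * ε * (b - a)) := by
  set E := {s ∈ Set.Icc a b | ‖P.eval (s : ℂ)‖ ≤ ε ^ d * ‖P.eval (v : ℂ)‖} with hE
  have hEc : IsCompact E := by
    have : IsClosed {s : ℝ | ‖P.eval (s : ℂ)‖ ≤ ε ^ d * ‖P.eval (v : ℂ)‖} :=
      isClosed_le (by fun_prop) (by fun_prop)
    exact isCompact_Icc.inter_right this
  have hd0 : (0 : ℝ) < d := by exact_mod_cast hd
  by_contra! hcon
  have hab : 0 ≤ b - a := by linarith [hv.1, hv.2]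
  have hnn : 0 ≤ 2 * Real.exp 1 * ε * (b - a) := by positivity
  obtain ⟨c, hc1, hc2⟩ := ENNReal.lt_iff_exists_nnreal_btwn.1 hcon
  have hc0 : 2 * Real.exp 1 * ε * (b - a) < c := by
    rwa [← ENNReal.ofReal_coe_nnreal, ENNReal.ofReal_lt_ofReal_iff_of_nonneg hnn] at hc1
  set δ : ℝ := c / d with hδd
  have hδ : 0 < δ := div_pos (hnn.trans_lt hc0) hd0
  have hdδ : d * δ = c := by rw [hδd]; field_simp
  obtain ⟨x, hxE, hsep⟩ := exists_separated_points hδ d E hEc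
    (by rwa [hdδ, ENNReal.ofReal_coe_nnreal])
  have habs : ∀ i ≤ d, ∀ j ≤ d, |(j : ℝ) - i| * δ ≤ |x j - x i| := by
    intro i hi j hj
    rcases le_total i j with h | h
    · rw [abs_of_nonneg (sub_nonneg.2 (Nat.cast_le.2 h))]
      exact (mul_sub_le_sub_of_separated hsep h hj).trans (le_abs_self _)
    · rw [abs_sub_comm, abs_sub_comm (x j), abs_of_nonneg (sub_nonneg.2 (Nat.cast_le.2 h))]
      exact (mul_sub_le_sub_of_separated hsep h hi).trans (le_abs_self _)
  have hinj : Set.InjOn (fun i : ℕ => (x i : ℂ)) (Finset.range (d + 1)) := by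
    intro i hi j hj hij
    have hi' : i ≤ d := Nat.lt_succ_iff.1 (Finset.mem_range.1 (Finset.mem_coe.1 hi))
    have hj' : j ≤ d := Nat.lt_succ_iff.1 (Finset.mem_range.1 (Finset.mem_coe.1 hj))
    have h0 : x i = x j := by simpa using hij
    have h1 := habs i hi' j hj'
    rw [h0, sub_self, abs_zero] at h1
    have h2 : |(j : ℝ) - i| ≤ 0 := by
      by_contra h
      exact absurd h1 (not_le.2 (mul_pos (not_le.1 h) hδ))
    have h3 : (j : ℝ) - i = 0 := abs_eq_zero.1 (le_antisymm h2 (abs_nonneg _))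
    exact_mod_cast (sub_eq_zero.1 h3).symm
  have hdeg : P.degree < (Finset.range (d + 1)).card := by
    rw [Finset.card_range]
    exact (Polynomial.degree_le_of_natDegree_le hP).trans_lt (by exact_mod_cast Nat.lt_succ_self d)
  have hint := congrArg (Polynomial.eval (v : ℂ)) (Lagrange.eq_interpolate hinj hdeg)
  rw [Lagrange.interpolate_apply, Polynomial.eval_finsetSum] at hint
  have hterm : ∀ j ∈ Finset.range (d + 1),
      ‖Polynomial.eval (v : ℂ) (Polynomial.C (P.eval (x j : ℂ)) *
        Lagrange.basis (Finset.range (d + 1)) (fun i : ℕ => (x i : ℂ)) j)‖ ≤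
      ε ^ d * ‖P.eval (v : ℂ)‖ * (((b - a) / δ) ^ d *
        ((j.factorial : ℝ) * (d - j).factorial)⁻¹) := by
    intro j hj
    have hj' : j ≤ d := Nat.lt_succ_iff.1 (Finset.mem_range.1 hj)
    rw [Polynomial.eval_mul, Polynomial.eval_C, norm_mul]
    refine mul_le_mul (hxE j hj').2 ?_ (norm_nonneg _) (by positivity)
    rw [Lagrange.basis, Polynomial.eval_prod, norm_prod, ← prod_abs_sub_range_erase hj',
      ← Finset.prod_inv_distrib]
    have hcard : ((Finset.range (d + 1)).erase j).card = d := by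
      rw [Finset.card_erase_of_mem hj, Finset.card_range, Nat.add_sub_cancel]
    calc _ ≤ ∏ i ∈ (Finset.range (d + 1)).erase j, ((b - a) / δ * |(j : ℝ) - i|⁻¹) := by
          refine Finset.prod_le_prod (fun _ _ => norm_nonneg _) fun i hi => ?_
          have hij : i ≠ j := Finset.ne_of_mem_erase hi
          have hi' : i ≤ d :=
            Nat.lt_succ_iff.1 (Finset.mem_range.1 (Finset.mem_of_mem_erase hi))
          have hpos : 0 < |(j : ℝ) - i| :=
            abs_pos.2 (sub_ne_zero.2 (by exact_mod_cast hij.symm))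
          rw [Lagrange.basisDivisor]
          simp only [Polynomial.eval_mul, Polynomial.eval_C, Polynomial.eval_sub,
            Polynomial.eval_X, norm_mul, norm_inv]
          rw [← Complex.ofReal_sub, ← Complex.ofReal_sub, Complex.norm_real, Complex.norm_real,
            Real.norm_eq_abs, Real.norm_eq_abs]
          have h1 : |v - x i| ≤ b - a := by
            have := (hxE i hi').1
            rw [abs_le]
            constructor <;> linarith [hv.1, hv.2, this.1, this.2]
          calc |x j - x i|⁻¹ * |v - x i| ≤ (|(j : ℝ) - i| * δ)⁻¹ * (b - a) := by
                gcongr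
                exact habs i hi' j hj'
            _ = _ := by rw [mul_inv]; ring
      _ = _ := by rw [Finset.prod_mul_distrib, Finset.prod_const, hcard]
  have hsum := (congrArg norm hint).le.trans
    ((norm_sum_le _ _).trans (Finset.sum_le_sum hterm))
  rw [← Finset.mul_sum, ← Finset.mul_sum, sum_inv_factorial_mul_factorial] at hsum
  have hv0 : 0 < ‖P.eval (v : ℂ)‖ := norm_pos_iff.2 hPv
  have h1 : 1 ≤ ε ^ d * (((b - a) / δ) ^ d * (2 ^ d / d.factorial)) := by
    have : 1 * ‖P.eval (v : ℂ)‖ ≤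
      ε ^ d * (((b - a) / δ) ^ d * (2 ^ d / d.factorial)) * ‖P.eval (v : ℂ)‖ := by
      linarith
    exact le_of_mul_le_mul_right this hv0
  have h2 : ε ^ d * (((b - a) / δ) ^ d * (2 ^ d / d.factorial)) ≤
      (2 * Real.exp 1 * ε * (b - a) / c) ^ d := by
    have h3 : (d : ℝ) ^ d / d.factorial ≤ Real.exp 1 ^ d := by
      rw [← Real.exp_nat_mul, mul_one]
      exact Real.pow_div_factorial_le_exp _ hd0.le _
    calc _ = (2 * ε * (b - a) / c) ^ d * ((d : ℝ) ^ d / d.factorial) := by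
          rw [hδd]; simp only [mul_pow, div_pow]; field_simp
      _ ≤ (2 * ε * (b - a) / c) ^ d * Real.exp 1 ^ d := by gcongr
      _ = _ := by rw [← mul_pow]; congr 1; ring
  have h4 : (2 * Real.exp 1 * ε * (b - a) / c) ^ d < 1 :=
    pow_lt_one₀ (by positivity) ((div_lt_one (hnn.trans_lt hc0)).2 hc0) (by omega)
  linarith

theorem lintegral_Ioi_ofReal_exp_neg (K B : ℝ) (hK : 0 ≤ K) :
    ∫⁻ t in Set.Ioi B, ENNReal.ofReal (K * Real.exp (-t)) =
      ENNReal.ofReal (K * Real.exp (-B)) := by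
  have hint : IntegrableOn (fun t => K * Real.exp (-t)) (Set.Ioi B) :=
    (integrableOn_exp_neg_Ioi B).const_mul K
  rw [← ofReal_integral_eq_lintegral_ofReal hint
    (Filter.Eventually.of_forall fun t => by positivity), integral_const_mul,
    integral_exp_neg_Ioi]

theorem ofReal_integral_pos_part {X : Type*} [MeasurableSpace X] {ρ : Measure X} {f : X → ℝ}
    (hf : Integrable f ρ) :
    ENNReal.ofReal (∫ x, max (f x) 0 ∂ρ) = ∫⁻ t in Set.Ioi 0, ρ {x | t < f x} := by
  rw [ofReal_integral_eq_lintegral_ofReal hf.pos_part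
      (Filter.Eventually.of_forall fun _ => le_max_right _ _),
    lintegral_eq_lintegral_meas_lt ρ (f := fun x => max (f x) 0)
      (Filter.Eventually.of_forall fun _ => le_max_right _ _) hf.pos_part.aemeasurable]
  refine setLIntegral_congr_fun measurableSet_Ioi fun t ht => ?_
  simp only [lt_max_iff, not_lt.2 (le_of_lt (Set.mem_Ioi.1 ht)), or_false]

section
variable {X : Type*} [MeasurableSpace X] {ρ : Measure X} [IsProbabilityMeasure ρ]
  {Q D : X → ℝ} {c : ℝ}

theorem measure_sublevel_exp_integral_log_le (hQpos : ∀ x, 0 < Q x)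
    (hg : Integrable (fun x => Real.log (Q x)) ρ) (hD0 : ∀ x, 0 ≤ D x)
    (hD : Integrable D ρ) (hD1 : ∫ x, D x ∂ρ ≤ 1)
    (hsub : ∀ v ε, 0 ≤ ε → ρ {x | Q x ≤ ε * Q v} ≤ ENNReal.ofReal (c * ε * (1 + D v)))
    {ε : ℝ} (hε : 0 ≤ ε) :
    ρ {x | Q x ≤ ε * Real.exp (∫ y, Real.log (Q y) ∂ρ)} ≤ ENNReal.ofReal (2 * c * ε) := by
  set m := ∫ y, Real.log (Q y) ∂ρ with hm
  have hDi : Integrable (fun x => (D x - 1) / 2) ρ := (hD.sub (integrable_const 1)).div_const 2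
  obtain ⟨v, hv⟩ := exists_integral_le (hg.sub hDi)
  simp only [Pi.sub_apply] at hv
  rw [integral_sub hg hDi, integral_div, integral_sub hD (integrable_const 1)] at hv
  simp only [integral_const, probReal_univ, smul_eq_mul, mul_one] at hv
  have hDv : 0 < 1 + D v := by linarith [hD0 v]
  have hQv : Real.exp m * ((1 + D v) / 2) ≤ Q v := by
    calc Real.exp m * ((1 + D v) / 2) ≤ Real.exp m * Real.exp ((D v - 1) / 2) := by
          gcongr
          linarith [Real.add_one_le_exp ((D v - 1) / 2)]
      _ = Real.exp (m + (D v - 1) / 2) := by rw [Real.exp_add]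
      _ ≤ Real.exp (Real.log (Q v)) := Real.exp_le_exp.2 (by linarith)
      _ = Q v := Real.exp_log (hQpos v)
  have h := hsub v (ε * (2 / (1 + D v))) (by positivity)
  have e1 : c * (ε * (2 / (1 + D v))) * (1 + D v) = 2 * c * ε := by field_simp
  rw [e1] at h
  refine (measure_mono fun x hx => ?_).trans h
  have hx' : Q x ≤ ε * Real.exp m := hx
  refine hx'.trans ?_
  calc ε * Real.exp m = ε * (2 / (1 + D v)) * (Real.exp m * ((1 + D v) / 2)) := by field_simp
    _ ≤ _ := by gcongr

theorem log_sub_integral_log_le (hQpos : ∀ x, 0 < Q x) (hc : 1 ≤ c)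
    (hg : Integrable (fun x => Real.log (Q x)) ρ) (hD0 : ∀ x, 0 ≤ D x)
    (hsub : ∀ v ε, 0 ≤ ε → ρ {x | Q x ≤ ε * Q v} ≤ ENNReal.ofReal (c * ε * (1 + D v)))
    (v : X) :
    Real.log (Q v) - ∫ y, Real.log (Q y) ∂ρ ≤ Real.log (c * (1 + D v)) + 1 := by
  set B := Real.log (c * (1 + D v)) with hB
  have hc1 : 1 ≤ c * (1 + D v) := by nlinarith [hD0 v]
  have hB0 : 0 ≤ B := Real.log_nonneg hc1
  have hexpB : Real.exp B = c * (1 + D v) := Real.exp_log (by linarith)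
  have hi : Integrable (fun x => Real.log (Q v) - Real.log (Q x)) ρ := (integrable_const _).sub hg
  have hip : Integrable (fun x => max (Real.log (Q v) - Real.log (Q x)) 0) ρ :=
    hi.pos_part
  have h1 : Real.log (Q v) - ∫ y, Real.log (Q y) ∂ρ ≤
      ∫ x, max (Real.log (Q v) - Real.log (Q x)) 0 ∂ρ := by
    calc _ = ∫ x, (Real.log (Q v) - Real.log (Q x)) ∂ρ := by
          rw [integral_sub (integrable_const _) hg]; simp
      _ ≤ _ := integral_mono hi hip fun x => le_max_left _ _
  refine h1.trans ?_
  rw [← ENNReal.ofReal_le_ofReal_iff (by linarith),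
    ofReal_integral_pos_part hi]
  rw [← Set.Ioc_union_Ioi_eq_Ioi hB0]
  refine (lintegral_union_le _ _ _).trans ?_
  rw [ENNReal.ofReal_add hB0 zero_le_one]
  refine add_le_add ?_ ?_
  · calc _ ≤ ∫⁻ t in Set.Ioc 0 B, 1 := lintegral_mono fun t => prob_le_one
      _ = _ := by simp
  · have : ∀ t ∈ Set.Ioi B, ρ {x | t < Real.log (Q v) - Real.log (Q x)} ≤
        ENNReal.ofReal (c * (1 + D v) * Real.exp (-t)) := by
      intro t ht
      have := hsub v (Real.exp (-t)) (Real.exp_pos _).le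
      rw [show c * Real.exp (-t) * (1 + D v) = c * (1 + D v) * Real.exp (-t) by ring] at this
      refine (measure_mono fun x hx => ?_).trans this
      have hx' : t < Real.log (Q v) - Real.log (Q x) := hx
      show Q x ≤ Real.exp (-t) * Q v
      rw [← Real.exp_log (hQpos x), ← Real.exp_log (hQpos v), ← Real.exp_add]
      exact Real.exp_le_exp.2 (by linarith)
    refine (setLIntegral_mono' measurableSet_Ioi this).trans ?_
    rw [lintegral_Ioi_ofReal_exp_neg _ _ (by linarith), Real.exp_neg, hexpB,
      mul_inv_cancel₀ (by linarith)]

/-- A Remez-type sublevel estimate controls the deviation of `log Q` from its mean. -/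
theorem integral_abs_log_sub_integral_log_sub_le (hQpos : ∀ x, 0 < Q x) (hc : 1 ≤ c)
    (hg : Integrable (fun x => Real.log (Q x)) ρ) (hD0 : ∀ x, 0 ≤ D x)
    (hD : Integrable D ρ) (hD1 : ∫ x, D x ∂ρ ≤ 1)
    (hsub : ∀ v ε, 0 ≤ ε → ρ {x | Q x ≤ ε * Q v} ≤ ENNReal.ofReal (c * ε * (1 + D v))) (a : ℝ) :
    ∫ x, max (|Real.log (Q x) - ∫ y, Real.log (Q y) ∂ρ| - a) 0 ∂ρ ≤ 4 * c * Real.exp (-a) := by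
  set m := ∫ y, Real.log (Q y) ∂ρ with hm
  have hgm : Integrable (fun x => Real.log (Q x) - m) ρ := hg.sub (integrable_const m)
  have hlowi : Integrable (fun x => m - Real.log (Q x) - a) ρ :=
    ((integrable_const m).sub hg).sub (integrable_const a)
  have hlow : Integrable (fun x => max (m - Real.log (Q x) - a) 0) ρ :=
    hlowi.pos_part
  have hup : Integrable (fun x => c * Real.exp (-a) * (1 + D x)) ρ :=
    ((integrable_const 1).add hD).const_mul _
  have hpt : ∀ x, max (|Real.log (Q x) - m| - a) 0 ≤
      max (m - Real.log (Q x) - a) 0 + c * Real.exp (-a) * (1 + D x) := by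
    intro x
    have h2 : Real.log (Q x) - m - a ≤ c * Real.exp (-a) * (1 + D x) := by
      have h3 := log_sub_integral_log_le hQpos hc hg hD0 hsub x
      have h4 : 0 < c * (1 + D x) := mul_pos (by linarith) (by linarith [hD0 x])
      have h5 := Real.add_one_le_exp (Real.log (Q x) - m - a - 1)
      calc Real.log (Q x) - m - a ≤ Real.exp (Real.log (Q x) - m - a - 1) := by linarith
        _ ≤ Real.exp (Real.log (c * (1 + D x)) + -a) := Real.exp_le_exp.2 (by linarith)
        _ = _ := by rw [Real.exp_add, Real.exp_log h4]; ring
    have h0 : 0 ≤ c * Real.exp (-a) * (1 + D x) := by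
      have := hD0 x
      positivity
    refine max_le ?_ (add_nonneg (le_max_right _ _) h0)
    rcases abs_cases (Real.log (Q x) - m) with ⟨h, _⟩ | ⟨h, _⟩ <;> rw [h]
    · linarith [le_max_right (m - Real.log (Q x) - a) 0]
    · linarith [le_max_left (m - Real.log (Q x) - a) 0]
  have hlowle : ∫ x, max (m - Real.log (Q x) - a) 0 ∂ρ ≤ 2 * c * Real.exp (-a) := by
    rw [← ENNReal.ofReal_le_ofReal_iff (by positivity),
      ofReal_integral_pos_part hlowi]
    have : ∀ t ∈ Set.Ioi (0 : ℝ), ρ {x | t < m - Real.log (Q x) - a} ≤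
        ENNReal.ofReal (2 * c * Real.exp (-a) * Real.exp (-t)) := by
      intro t ht
      have := measure_sublevel_exp_integral_log_le hQpos hg hD0 hD hD1 hsub
        (Real.exp_pos (-a + -t)).le
      rw [Real.exp_add, ← mul_assoc] at this
      refine (measure_mono fun x hx => ?_).trans this
      have hx' : t < m - Real.log (Q x) - a := hx
      show Q x ≤ Real.exp (-a) * Real.exp (-t) * Real.exp m
      rw [← Real.exp_add, ← Real.exp_add, ← Real.exp_log (hQpos x)]
      exact Real.exp_le_exp.2 (by linarith)
    refine (setLIntegral_mono' measurableSet_Ioi this).trans ?_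
    rw [lintegral_Ioi_ofReal_exp_neg _ _ (by positivity)]
    simp
  calc _ ≤ ∫ x, (max (m - Real.log (Q x) - a) 0 + c * Real.exp (-a) * (1 + D x)) ∂ρ :=
        integral_mono (hgm.abs.sub (integrable_const a)).pos_part (hlow.add hup) hpt
    _ = ∫ x, max (m - Real.log (Q x) - a) 0 ∂ρ + c * Real.exp (-a) * (1 + ∫ x, D x ∂ρ) := by
        rw [integral_add hlow hup, integral_const_mul, integral_add (integrable_const 1) hD]
        simp
    _ ≤ 2 * c * Real.exp (-a) + c * Real.exp (-a) * (1 + 1) := by gcongr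
    _ = _ := by ring

end

/-- A logarithmically concave weight has first absolute moment about its mode at most
its squared mass divided by the modal value. -/
theorem mul_lintegral_abs_mul_le_sq {f : ℝ → ENNReal} (hf : Measurable f) {x₀ : ℝ}
    (hlc : ∀ s, ∀ a ∈ Set.uIcc x₀ s, f x₀ * f s ≤ f a * f (x₀ + s - a)) :
    f x₀ * ∫⁻ s, ENNReal.ofReal |s - x₀| * f s ≤ (∫⁻ s, f s) ^ 2 := by
  have hmeas : Measurable (Function.uncurry fun a s : ℝ => f a * f (x₀ + s - a)) := by
    unfold Function.uncurry
    fun_prop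
  calc f x₀ * ∫⁻ s, ENNReal.ofReal |s - x₀| * f s
      = ∫⁻ s, ENNReal.ofReal |s - x₀| * (f x₀ * f s) := by
        rw [← lintegral_const_mul _ (by fun_prop)]
        refine lintegral_congr fun s => by ring
    _ = ∫⁻ s, ∫⁻ _ in Set.uIcc x₀ s, f x₀ * f s := by
        refine lintegral_congr fun s => ?_
        rw [setLIntegral_const, Real.volume_interval, mul_comm]
    _ ≤ ∫⁻ s, ∫⁻ a in Set.uIcc x₀ s, f a * f (x₀ + s - a) :=
        lintegral_mono fun s => setLIntegral_mono' measurableSet_uIcc (hlc s)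
    _ ≤ ∫⁻ s, ∫⁻ a, f a * f (x₀ + s - a) :=
        lintegral_mono fun s => setLIntegral_le_lintegral _ _
    _ = ∫⁻ a, ∫⁻ s, f a * f (x₀ + s - a) := (lintegral_lintegral_swap hmeas.aemeasurable).symm
    _ = ∫⁻ a, f a * ∫⁻ s, f s := by
        refine lintegral_congr fun a => ?_
        rw [lintegral_const_mul _ (by fun_prop)]
        congr 1
        have : ∀ s, f (x₀ + s - a) = f (s + (x₀ - a)) := fun s => by congr 1; ring
        simp_rw [this]
        exact lintegral_add_right_eq_self f _
    _ = _ := by rw [lintegral_mul_const _ hf, sq]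

theorem volume_inter_ordConnected_le {Q : ℝ → ℝ} {c : ℝ}
    (hQ : ∀ a b v ε, v ∈ Set.Icc a b → 0 ≤ ε →
      volume {s ∈ Set.Icc a b | Q s ≤ ε * Q v} ≤ ENNReal.ofReal (c * ε * (b - a)))
    {S : Set ℝ} (hS : S.OrdConnected) (hSb : Bornology.IsBounded S) {x₀ : ℝ} (hx₀ : x₀ ∈ S)
    (hc : 0 ≤ c) {ε : ℝ} (hε : 0 ≤ ε) (v : ℝ) :
    volume ({s | Q s ≤ ε * Q v} ∩ S) ≤
      ENNReal.ofReal (c * ε) * (volume S + ENNReal.ofReal |v - x₀|) := by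
  have hne : S.Nonempty := ⟨x₀, hx₀⟩
  have hba := hSb.bddAbove
  have hbb := hSb.bddBelow
  set A := min (sInf S) v
  set B := max (sSup S) v
  have hAx : sInf S ≤ x₀ := csInf_le hbb hx₀
  have hxB : x₀ ≤ sSup S := le_csSup hba hx₀
  have hvol : ENNReal.ofReal (sSup S - sInf S) ≤ volume S := by
    rw [← Real.volume_Ioo]
    refine measure_mono fun y hy => ?_
    obtain ⟨p, hp, hpy⟩ := exists_lt_of_csInf_lt hne hy.1
    obtain ⟨q, hq, hyq⟩ := exists_lt_of_lt_csSup hne hy.2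
    exact hS.out hp hq ⟨hpy.le, hyq.le⟩
  have hlen : B - A ≤ (sSup S - sInf S) + |v - x₀| := by
    rcases le_total (sInf S) v with h1 | h1 <;> rcases le_total (sSup S) v with h2 | h2 <;>
      simp only [A, B, h1, h2, min_eq_left, min_eq_right, max_eq_left, max_eq_right] <;>
      rcases abs_cases (v - x₀) with ⟨h, _⟩ | ⟨h, _⟩ <;> rw [h] <;> linarith
  have hsub : {s | Q s ≤ ε * Q v} ∩ S ⊆ {s ∈ Set.Icc A B | Q s ≤ ε * Q v} := by
    rintro s ⟨hs, hsS⟩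
    exact ⟨⟨(min_le_left _ _).trans (csInf_le hbb hsS),
      (le_csSup hba hsS).trans (le_max_left _ _)⟩, hs⟩
  calc _ ≤ ENNReal.ofReal (c * ε * (B - A)) := (measure_mono hsub).trans
        (hQ A B v ε ⟨min_le_right _ _, le_max_right _ _⟩ hε)
    _ ≤ ENNReal.ofReal (c * ε * ((sSup S - sInf S) + |v - x₀|)) := by gcongr
    _ ≤ _ := by
        rw [ENNReal.ofReal_mul (by positivity), ENNReal.ofReal_add (by linarith) (abs_nonneg _)]
        gcongr

theorem setLIntegral_sublevel_le {Q : ℝ → ℝ} {c : ℝ} (hc : 0 ≤ c) (hQc : Continuous Q)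
    (hQ : ∀ a b v ε, v ∈ Set.Icc a b → 0 ≤ ε →
      volume {s ∈ Set.Icc a b | Q s ≤ ε * Q v} ≤ ENNReal.ofReal (c * ε * (b - a)))
    {w : ℝ → ℝ} (hw : Measurable w) (hw0 : ∀ x, 0 ≤ w x)
    (hwb : Bornology.IsBounded (Function.support w)) {x₀ : ℝ} (hx₀ : ∀ x, w x ≤ w x₀)
    (hconn : ∀ t, {x | t < w x}.OrdConnected) (v : ℝ) {ε : ℝ} (hε : 0 ≤ ε) :
    ∫⁻ x in {x | Q x ≤ ε * Q v}, ENNReal.ofReal (w x) ≤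
      ENNReal.ofReal (c * ε) *
        ((∫⁻ x, ENNReal.ofReal (w x)) + ENNReal.ofReal (w x₀ * |v - x₀|)) := by
  have hA : MeasurableSet {x | Q x ≤ ε * Q v} :=
    (isClosed_le hQc continuous_const).measurableSet
  rw [lintegral_eq_lintegral_meas_lt _ (Filter.Eventually.of_forall hw0) hw.aemeasurable,
    lintegral_eq_lintegral_meas_lt _ (Filter.Eventually.of_forall hw0) hw.aemeasurable]
  have hle : ∀ t ∈ Set.Ioi (0 : ℝ), (volume.restrict {x | Q x ≤ ε * Q v}) {x | t < w x} ≤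
      ENNReal.ofReal (c * ε) * (volume {x | t < w x} +
        (Set.Iio (w x₀)).indicator (fun _ => ENNReal.ofReal |v - x₀|) t) := by
    intro t ht
    rw [Measure.restrict_apply (measurableSet_lt measurable_const hw), Set.inter_comm]
    by_cases htw : t < w x₀
    · rw [Set.indicator_of_mem (Set.mem_Iio.2 htw)]
      refine volume_inter_ordConnected_le hQ (hconn t) (hwb.subset fun x hx => ?_) htw hc hε v
      exact ((Set.mem_Ioi.1 ht).trans hx).ne'
    · have : {x | t < w x} = ∅ := by
        ext x
        simpa using (hx₀ x).trans (not_lt.1 htw)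
      simp [this]
  refine (setLIntegral_mono' measurableSet_Ioi hle).trans ?_
  rw [lintegral_const_mul' _ _ ENNReal.ofReal_ne_top,
    lintegral_add_right _ (measurable_const.indicator measurableSet_Iio)]
  gcongr
  rw [lintegral_indicator_const measurableSet_Iio, Measure.restrict_apply measurableSet_Iio,
    Set.inter_comm, Set.Ioi_inter_Iio, Real.volume_Ioo, sub_zero, mul_comm,
    ← ENNReal.ofReal_mul (hw0 _)]

theorem ordConnected_superlevel_of_logConcave {w : ℝ → ℝ} (hw0 : ∀ x, 0 ≤ w x)
    (hlc : ∀ x y l, l ∈ Set.Icc (0 : ℝ) 1 → w x ^ (1 - l) * w y ^ l ≤ w ((1 - l) * x + l * y))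
    (t : ℝ) : {x | t < w x}.OrdConnected := by
  rcases lt_or_ge t 0 with ht | ht
  · have : {x | t < w x} = Set.univ := Set.eq_univ_of_forall fun x => ht.trans_le (hw0 x)
    rw [this]
    exact Set.ordConnected_univ
  refine Convex.ordConnected fun x hx y hy a b ha hb hab => ?_
  have hx' : t < w x := hx
  have hy' : t < w y := hy
  have hmin : t < min (w x) (w y) := lt_min hx' hy'
  have hmin0 : 0 < min (w x) (w y) := ht.trans_lt hmin
  have h := hlc x y b ⟨hb, by linarith⟩
  have h1 : 1 - b = a := by linarith
  rw [h1] at h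
  refine lt_of_lt_of_le hmin (le_trans ?_ h)
  calc min (w x) (w y) = min (w x) (w y) ^ a * min (w x) (w y) ^ b := by
        rw [← Real.rpow_add hmin0, hab, Real.rpow_one]
    _ ≤ _ := mul_le_mul (Real.rpow_le_rpow hmin0.le (min_le_left _ _) ha)
        (Real.rpow_le_rpow hmin0.le (min_le_right _ _) hb) (by positivity)
        (Real.rpow_nonneg (hw0 _) _)

theorem mul_le_mul_of_logConcave {w : ℝ → ℝ} (hw0 : ∀ x, 0 ≤ w x)
    (hlc : ∀ x y l, l ∈ Set.Icc (0 : ℝ) 1 → w x ^ (1 - l) * w y ^ l ≤ w ((1 - l) * x + l * y))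
    {x₀ s a : ℝ} (ha : a ∈ Set.uIcc x₀ s) : w x₀ * w s ≤ w a * w (x₀ + s - a) := by
  rw [← segment_eq_uIcc] at ha
  obtain ⟨p, q, hp, hq, hpq, rfl⟩ := ha
  have hp1 : p = 1 - q := by linarith
  subst hp1
  have h1 := hlc x₀ s q ⟨hq, by linarith⟩
  have h2 := hlc x₀ s (1 - q) ⟨hp, by linarith⟩
  have e : x₀ + s - ((1 - q) • x₀ + q • s) = (1 - (1 - q)) * x₀ + (1 - q) * s := by
    simp only [smul_eq_mul]; ring
  rw [e]
  have h0 : ∀ z, w z ^ (1 - q) * w z ^ q = w z := fun z => by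
    rw [← Real.rpow_add_of_nonneg (hw0 z) hp hq, hpq, Real.rpow_one]
  calc w x₀ * w s = (w x₀ ^ (1 - q) * w s ^ q) * (w x₀ ^ (1 - (1 - q)) * w s ^ (1 - q)) := by
        nth_rewrite 1 [← h0 x₀, ← h0 s]
        rw [sub_sub_cancel]
        ring
    _ ≤ _ := by
        have := hw0 x₀
        have := hw0 s
        refine mul_le_mul h1 h2 (by positivity) (hw0 _)

theorem integral_abs_log_sub_le_of_logConcave {Q : ℝ → ℝ} {c : ℝ} (hc : 1 ≤ c)
    (hQc : Continuous Q) (hQpos : ∀ x, 0 < Q x)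
    (hQ : ∀ a b v ε, v ∈ Set.Icc a b → 0 ≤ ε →
      volume {s ∈ Set.Icc a b | Q s ≤ ε * Q v} ≤ ENNReal.ofReal (c * ε * (b - a)))
    {w : ℝ → ℝ} (hw : Measurable w) (hw0 : ∀ x, 0 ≤ w x)
    (hwb : Bornology.IsBounded (Function.support w)) {x₀ : ℝ} (hx₀ : ∀ x, w x ≤ w x₀)
    (hlc : ∀ x y l, l ∈ Set.Icc (0 : ℝ) 1 → w x ^ (1 - l) * w y ^ l ≤ w ((1 - l) * x + l * y))
    {ρ : Measure ℝ} [IsProbabilityMeasure ρ]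
    (hρ : ρ = volume.withDensity fun x => ENNReal.ofReal (w x)) (a : ℝ) :
    ∫ x, max (|Real.log (Q x) - ∫ y, Real.log (Q y) ∂ρ| - a) 0 ∂ρ ≤ 4 * c * Real.exp (-a) := by
  have hmass : ∫⁻ x, ENNReal.ofReal (w x) = 1 := by
    have : ρ Set.univ = 1 := measure_univ
    rwa [hρ, withDensity_apply _ MeasurableSet.univ, setLIntegral_univ] at this
  obtain ⟨R, hR⟩ := hwb.subset_closedBall 0
  have hae : ∀ᵐ x ∂ρ, x ∈ Metric.closedBall (0 : ℝ) R := by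
    rw [hρ, ae_withDensity_iff (by fun_prop)]
    refine Filter.Eventually.of_forall fun x hx => hR ?_
    intro h
    simp [h] at hx
  have hcont : ∀ h : ℝ → ℝ, Continuous h → Integrable h ρ := fun h hh => by
    have := hh.continuousOn.integrableOn_compact (μ := ρ) (isCompact_closedBall (0 : ℝ) R)
    rwa [IntegrableOn, Measure.restrict_eq_self_of_ae_mem hae] at this
  refine integral_abs_log_sub_integral_log_sub_le (D := fun x => w x₀ * |x - x₀|) hQpos hc
    (hcont _ (hQc.log fun x => (hQpos x).ne')) (fun x => mul_nonneg (hw0 _) (abs_nonneg _))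
    (hcont _ (by fun_prop)) ?_ ?_ a
  · rw [← ENNReal.ofReal_le_ofReal_iff zero_le_one,
      ofReal_integral_eq_lintegral_ofReal (hcont _ (by fun_prop))
        (Filter.Eventually.of_forall fun x => mul_nonneg (hw0 _) (abs_nonneg _)),
      hρ, lintegral_withDensity_eq_lintegral_mul _ (by fun_prop) (by fun_prop)]
    have h := mul_lintegral_abs_mul_le_sq (f := fun x => ENNReal.ofReal (w x)) (by fun_prop)
      (x₀ := x₀) fun s b hb => by
        rw [← ENNReal.ofReal_mul (hw0 _), ← ENNReal.ofReal_mul (hw0 _)]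
        exact ENNReal.ofReal_le_ofReal (mul_le_mul_of_logConcave hw0 hlc hb)
    rw [hmass, one_pow, ← lintegral_const_mul _ (by fun_prop)] at h
    rw [ENNReal.ofReal_one]
    refine le_trans (le_of_eq (lintegral_congr fun x => ?_)) h
    rw [Pi.mul_apply, ENNReal.ofReal_mul (hw0 _)]
    ring
  · intro v ε hε
    have h := setLIntegral_sublevel_le (by linarith) hQc hQ hw hw0 hwb hx₀
      (ordConnected_superlevel_of_logConcave hw0 hlc) v hε
    rw [hmass] at h
    rw [hρ, withDensity_apply _ (isClosed_le hQc continuous_const).measurableSet]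
    refine h.trans (le_of_eq ?_)
    rw [ENNReal.ofReal_mul (by positivity : 0 ≤ c * ε),
      ENNReal.ofReal_add zero_le_one (mul_nonneg (hw0 _) (abs_nonneg _)), ENNReal.ofReal_one]

theorem volume_convexComb_le_of_isCompact {A B C : Set ℝ} (hA : IsCompact A) (hB : IsCompact B)
    (hA0 : A.Nonempty) (hB0 : B.Nonempty) {l : ℝ} (hl0 : 0 < l) (hl1 : l < 1)
    (hC : ∀ x ∈ A, ∀ y ∈ B, (1 - l) * x + l * y ∈ C) :
    ENNReal.ofReal (1 - l) * volume A + ENNReal.ofReal l * volume B ≤ volume C := by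
  obtain ⟨a, ha, hAa⟩ := hA.exists_isGreatest hA0
  obtain ⟨b, hb, hBb⟩ := hB.exists_isLeast hB0
  have key : ∀ (S : Set ℝ) (p q : ℝ), 0 < p →
      volume ((fun x => p * x + q) '' S) = ENNReal.ofReal p * volume S := fun S p q hp => by
    have : (fun x => p * x + q) = (fun x => x + q) ∘ fun x => p • x := rfl
    rw [this, Set.image_comp, Set.image_add_right, measure_preimage_add_right, Set.image_smul,
      Measure.addHaar_smul]
    simp [abs_of_pos hp]
  have key2 : ∀ (S : Set ℝ) (p q : ℝ), IsCompact S →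
      MeasurableSet ((fun x => p * x + q) '' S) := fun S p q hS =>
    (hS.image (by fun_prop)).measurableSet
  rw [← key A (1 - l) (l * b) (by linarith), ← key B l ((1 - l) * a) hl0,
    ← measure_union_add_inter _ (key2 B l _ hB)]
  have hI : volume ((fun x => (1 - l) * x + l * b) '' A ∩ (fun x => l * x + (1 - l) * a) '' B)
      = 0 := by
    refine measure_mono_null (t := {(1 - l) * a + l * b}) ?_ (by simp)
    rintro _ ⟨⟨x, hx, rfl⟩, y, hy, hxy⟩
    have h1 : x ≤ a := hAa hx
    have h2 : b ≤ y := hBb hy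
    simp only [Set.mem_singleton_iff] at hxy ⊢
    nlinarith
  rw [hI, add_zero]
  refine measure_mono ?_
  rintro _ (⟨x, hx, rfl⟩ | ⟨y, hy, rfl⟩)
  · exact hC x hx b hb
  · have := hC a ha y hy
    rwa [add_comm] at this

theorem volume_convexComb_le {A B C : Set ℝ} (hA : MeasurableSet A) (hB : MeasurableSet B)
    (hA0 : A.Nonempty) (hB0 : B.Nonempty) {l : ℝ} (hl0 : 0 < l) (hl1 : l < 1)
    (hC : ∀ x ∈ A, ∀ y ∈ B, (1 - l) * x + l * y ∈ C) :
    ENNReal.ofReal (1 - l) * volume A + ENNReal.ofReal l * volume B ≤ volume C := by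
  obtain ⟨a, ha⟩ := hA0
  obtain ⟨b, hb⟩ := hB0
  rw [hA.measure_eq_iSup_isCompact, hB.measure_eq_iSup_isCompact]
  simp only [ENNReal.mul_iSup]
  simp only [iSup_and']
  refine ENNReal.biSup_add_biSup_le' ⟨∅, Set.empty_subset _, isCompact_empty⟩
    ⟨∅, Set.empty_subset _, isCompact_empty⟩ fun K hK L hL => ?_
  have h := volume_convexComb_le_of_isCompact (hK.2.insert a) (hL.2.insert b)
    (Set.insert_nonempty _ _) (Set.insert_nonempty _ _) hl0 hl1 (C := C) fun x hx y hy =>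
      hC x (Set.insert_subset ha hK.1 hx) y (Set.insert_subset hb hL.1 hy)
  refine le_trans ?_ h
  gcongr
  · exact Set.subset_insert _ _
  · exact Set.subset_insert _ _

theorem lintegral_ofReal_eq_setLIntegral_Ioo {f : ℝ → ℝ} (hf : Measurable f)
    (hf0 : ∀ x, 0 ≤ f x) (hf1 : ∀ x, f x ≤ 1) :
    ∫⁻ x, ENNReal.ofReal (f x) = ∫⁻ s in Set.Ioo 0 1, volume {x | s < f x} := by
  rw [lintegral_eq_lintegral_meas_lt volume (Filter.Eventually.of_forall hf0) hf.aemeasurable,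
    ← lintegral_indicator measurableSet_Ioi, ← lintegral_indicator measurableSet_Ioo]
  refine lintegral_congr fun s => ?_
  by_cases hs : s ∈ Set.Ioo (0 : ℝ) 1
  · rw [Set.indicator_of_mem hs, Set.indicator_of_mem (Set.mem_Ioi.2 hs.1)]
  · rw [Set.indicator_of_notMem hs]
    by_cases hs0 : 0 < s
    · rw [Set.indicator_of_mem (Set.mem_Ioi.2 hs0)]
      have : {x | s < f x} = ∅ := by
        refine Set.eq_empty_of_forall_notMem fun x hx => hs ⟨hs0, ?_⟩
        exact lt_of_lt_of_le hx (hf1 x)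
      rw [this, measure_empty]
    · rw [Set.indicator_of_notMem (by simpa using hs0)]

theorem prekopa_leindler_normalized {f g h : ℝ → ℝ} (hf : Measurable f) (hg : Measurable g)
    (hh : Measurable h) (hf0 : ∀ x, 0 ≤ f x) (hg0 : ∀ x, 0 ≤ g x) (hh0 : ∀ x, 0 ≤ h x)
    (hf1 : ∀ x, f x ≤ 1) (hg1 : ∀ x, g x ≤ 1) (hfs : ∀ s < 1, ∃ x, s < f x)
    (hgs : ∀ s < 1, ∃ x, s < g x) {l : ℝ} (hl0 : 0 < l)
    (hl1 : l < 1) (hfg : ∀ x y, f x ^ (1 - l) * g y ^ l ≤ h ((1 - l) * x + l * y)) :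
    ENNReal.ofReal (1 - l) * (∫⁻ x, ENNReal.ofReal (f x)) +
      ENNReal.ofReal l * (∫⁻ x, ENNReal.ofReal (g x)) ≤ ∫⁻ x, ENNReal.ofReal (h x) := by
  have hanti : ∀ u : ℝ → ℝ, Measurable fun s => volume {x | s < u x} := fun u =>
    Antitone.measurable fun s t hst => measure_mono fun x hx => lt_of_le_of_lt hst hx
  rw [lintegral_ofReal_eq_setLIntegral_Ioo hf hf0 hf1,
    lintegral_ofReal_eq_setLIntegral_Ioo hg hg0 hg1,
    ← lintegral_const_mul _ (hanti f), ← lintegral_const_mul _ (hanti g),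
    ← lintegral_add_left ((hanti f).const_mul _),
    lintegral_eq_lintegral_meas_lt volume (Filter.Eventually.of_forall hh0) hh.aemeasurable]
  refine le_trans (setLIntegral_mono (hanti h) fun s hs => ?_)
    (lintegral_mono_set Set.Ioo_subset_Ioi_self)
  refine volume_convexComb_le (measurableSet_lt measurable_const hf)
    (measurableSet_lt measurable_const hg) (hfs s hs.2) (hgs s hs.2) hl0 hl1 fun x hx y hy => ?_
  have hx' : s < f x := hx
  have hy' : s < g y := hy
  refine lt_of_lt_of_le ?_ (hfg x y)
  calc s = s ^ (1 - l) * s ^ l := by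
        rw [← Real.rpow_add hs.1, sub_add_cancel, Real.rpow_one]
    _ < _ := mul_lt_mul (Real.rpow_lt_rpow hs.1.le hx' (by linarith))
        (Real.rpow_le_rpow hs.1.le hy'.le hl0.le) (Real.rpow_pos_of_pos hs.1 _)
        (Real.rpow_nonneg (hf0 _) _)

/-- The one-dimensional Prékopa–Leindler inequality for bounded functions. -/
theorem prekopa_leindler_real {f g h : ℝ → ℝ} (hf : Measurable f) (hg : Measurable g)
    (hh : Measurable h) (hf0 : ∀ x, 0 ≤ f x) (hg0 : ∀ x, 0 ≤ g x) (hh0 : ∀ x, 0 ≤ h x)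
    (hfb : BddAbove (Set.range f)) (hgb : BddAbove (Set.range g))
    (hfi : ∫⁻ x, ENNReal.ofReal (f x) ≠ ⊤) (hgi : ∫⁻ x, ENNReal.ofReal (g x) ≠ ⊤)
    {l : ℝ} (hl0 : 0 < l)
    (hl1 : l < 1) (hfg : ∀ x y, f x ^ (1 - l) * g y ^ l ≤ h ((1 - l) * x + l * y)) :
    (∫⁻ x, ENNReal.ofReal (f x)) ^ (1 - l) * (∫⁻ x, ENNReal.ofReal (g x)) ^ l ≤
      ∫⁻ x, ENNReal.ofReal (h x) := by
  have hl1' : 0 < 1 - l := by linarith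
  set α := sSup (Set.range f)
  set β := sSup (Set.range g)
  have hfα : ∀ x, f x ≤ α := fun x => le_csSup hfb ⟨x, rfl⟩
  have hgβ : ∀ x, g x ≤ β := fun x => le_csSup hgb ⟨x, rfl⟩
  rcases ((hf0 0).trans (hfα 0)).eq_or_lt with hα | hα
  · have : ∀ x, f x = 0 := fun x => le_antisymm ((hfα x).trans hα.symm.le) (hf0 x)
    simp [this, hl1']
  rcases ((hg0 0).trans (hgβ 0)).eq_or_lt with hβ | hβ
  · have : ∀ x, g x = 0 := fun x => le_antisymm ((hgβ x).trans hβ.symm.le) (hg0 x)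
    simp [this, hl0]
  have hγ : 0 < α ^ (1 - l) * β ^ l := by positivity
  have hsup : ∀ u : ℝ → ℝ, 0 < sSup (Set.range u) → ∀ s < 1,
      ∃ x, s < u x / sSup (Set.range u) := fun u hu s hs => by
    obtain ⟨_, ⟨x, rfl⟩, hx⟩ := exists_lt_of_lt_csSup (Set.range_nonempty u)
      (show s * sSup (Set.range u) < sSup (Set.range u) by nlinarith)
    exact ⟨x, (lt_div_iff₀ hu).2 hx⟩
  have hscale : ∀ (u : ℝ → ℝ) (r : ℝ), 0 < r → ∫⁻ x, ENNReal.ofReal (u x) =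
      ENNReal.ofReal r * ∫⁻ x, ENNReal.ofReal (u x / r) := fun u r hr => by
    rw [← lintegral_const_mul' _ _ ENNReal.ofReal_ne_top]
    refine lintegral_congr fun x => ?_
    rw [← ENNReal.ofReal_mul hr.le, mul_div_cancel₀ _ hr.ne']
  have main := prekopa_leindler_normalized (f := fun x => f x / α) (g := fun x => g x / β)
    (h := fun x => h x / (α ^ (1 - l) * β ^ l)) (hf.div_const _) (hg.div_const _)
    (hh.div_const _) (fun x => div_nonneg (hf0 x) hα.le) (fun x => div_nonneg (hg0 x) hβ.le)
    (fun x => div_nonneg (hh0 x) hγ.le) (fun x => (div_le_one hα).2 (hfα x))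
    (fun x => (div_le_one hβ).2 (hgβ x)) (hsup f hα) (hsup g hβ) hl0 hl1 fun x y => by
      rw [Real.div_rpow (hf0 _) hα.le, Real.div_rpow (hg0 _) hβ.le, div_mul_div_comm]
      exact div_le_div_of_nonneg_right (hfg x y) hγ.le
  rw [hscale f α hα] at hfi ⊢
  rw [hscale g β hβ] at hgi ⊢
  rw [hscale h _ hγ]
  have hfi' : ∫⁻ x, ENNReal.ofReal (f x / α) ≠ ⊤ := fun h =>
    hfi (by rw [h, ENNReal.mul_top (by simpa using hα)])
  have hgi' : ∫⁻ x, ENNReal.ofReal (g x / β) ≠ ⊤ := fun h =>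
    hgi (by rw [h, ENNReal.mul_top (by simpa using hβ)])
  generalize (∫⁻ x, ENNReal.ofReal (f x / α)) = I at *
  generalize (∫⁻ x, ENNReal.ofReal (g x / β)) = J at *
  lift I to NNReal using hfi'
  lift J to NNReal using hgi'
  have amgm := NNReal.geom_mean_le_arith_mean2_weighted (Real.toNNReal (1 - l)) (Real.toNNReal l)
    I J (by rw [← Real.toNNReal_add hl1'.le hl0.le]; simp)
  rw [Real.coe_toNNReal _ hl1'.le, Real.coe_toNNReal _ hl0.le, ← ENNReal.coe_le_coe] at amgm
  push_cast at amgm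
  rw [ENNReal.mul_rpow_of_nonneg _ _ hl1'.le, ENNReal.mul_rpow_of_nonneg _ _ hl0.le,
    ENNReal.ofReal_rpow_of_pos hα, ENNReal.ofReal_rpow_of_pos hβ, mul_mul_mul_comm,
    ← ENNReal.ofReal_mul (by positivity)]
  gcongr
  refine le_trans ?_ main
  refine le_trans (le_of_eq ?_) amgm
  rw [ENNReal.coe_rpow_of_nonneg _ hl1'.le, ENNReal.coe_rpow_of_nonneg _ hl0.le]

theorem volume_eq_lintegral_volume_section {n : ℕ} {A : Set (Fin (n + 1) → ℝ)}
    (hA : MeasurableSet A) :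
    volume A = ∫⁻ t : ℝ, volume {y : Fin n → ℝ | Fin.cons t y ∈ A} := by
  have h := (volume_preserving_piFinSuccAbove (fun _ : Fin (n + 1) => ℝ) 0).symm
  rw [← h.measure_preimage hA.nullMeasurableSet]
  rw [Measure.volume_eq_prod, Measure.prod_apply (h.measurable hA)]
  refine lintegral_congr fun t => ?_
  congr 1
  ext y
  simp [MeasurableEquiv.piFinSuccAbove, Fin.insertNthEquiv]

theorem continuous_finCons_uncurry {n : ℕ} :
    Continuous fun p : ℝ × (Fin n → ℝ) => (Fin.cons p.1 p.2 : Fin (n + 1) → ℝ) :=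
  continuous_pi fun i => by
    refine Fin.cases ?_ (fun j => ?_) i
    · simpa using continuous_fst
    · simpa [Function.comp_def] using (continuous_apply j).comp continuous_snd

theorem section_subset_image_tail {n : ℕ} (S : Set (Fin (n + 1) → ℝ)) (t : ℝ) :
    {y : Fin n → ℝ | Fin.cons t y ∈ S} ⊆ Fin.tail '' S :=
  fun y hy => ⟨Fin.cons t y, hy, by simp⟩

theorem isCompact_image_tail {n : ℕ} {S : Set (Fin (n + 1) → ℝ)} (hS : IsCompact S) :
    IsCompact (Fin.tail '' S : Set (Fin n → ℝ)) :=
  hS.image (continuous_pi fun i => continuous_apply i.succ)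

theorem isCompact_section {n : ℕ} {S : Set (Fin (n + 1) → ℝ)} (hS : IsCompact S) (t : ℝ) :
    IsCompact {y : Fin n → ℝ | Fin.cons t y ∈ S} :=
  (isCompact_image_tail hS).of_isClosed_subset (hS.isClosed.preimage
    (continuous_finCons_uncurry.comp (Continuous.prodMk_right t))) (section_subset_image_tail S t)

theorem measurable_volume_section {n : ℕ} {S : Set (Fin (n + 1) → ℝ)} (hS : MeasurableSet S) :
    Measurable fun t : ℝ => (volume {y : Fin n → ℝ | Fin.cons t y ∈ S}).toReal :=
  (measurable_measure_prodMk_left (continuous_finCons_uncurry.measurable hS)).ennreal_toReal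

theorem brunn_minkowski_multiplicative {n : ℕ} : ∀ {A B C : Set (Fin n → ℝ)}, IsCompact A →
    IsCompact B → IsCompact C → ∀ {l : ℝ}, 0 < l → l < 1 →
    (∀ x ∈ A, ∀ y ∈ B, (1 - l) • x + l • y ∈ C) →
    volume A ^ (1 - l) * volume B ^ l ≤ volume C := by
  induction n with
  | zero =>
    intro A B C hA hB hC l hl0 hl1 h
    have hl1' : 0 < 1 - l := by linarith
    rcases A.eq_empty_or_nonempty with rfl | ⟨a, ha⟩
    · simp [hl1']
    rcases B.eq_empty_or_nonempty with rfl | ⟨b, hb⟩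
    · simp [hl0]
    have key : ∀ (S : Set (Fin 0 → ℝ)) (x), x ∈ S → volume S = 1 := fun S x hx => by
      rw [Measure.volume_pi_eq_dirac x, Measure.dirac_apply_of_mem hx]
    rw [key A a ha, key B b hb, key C _ (h a ha b hb)]
    simp
  | succ n ih =>
    intro A B C hA hB hC l hl0 hl1 h
    have hl1' : 0 < 1 - l := by linarith
    have hbdd : ∀ {S : Set (Fin (n + 1) → ℝ)}, IsCompact S →
        BddAbove (Set.range fun t : ℝ => (volume {y : Fin n → ℝ | Fin.cons t y ∈ S}).toReal) := by
      rintro S hS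
      refine ⟨(volume (Fin.tail '' S : Set (Fin n → ℝ))).toReal, ?_⟩
      rintro _ ⟨t, rfl⟩
      exact ENNReal.toReal_mono (isCompact_image_tail hS).measure_lt_top.ne
        (measure_mono (section_subset_image_tail S t))
    have heq : ∀ {S : Set (Fin (n + 1) → ℝ)}, IsCompact S → volume S =
        ∫⁻ t : ℝ, ENNReal.ofReal (volume {y : Fin n → ℝ | Fin.cons t y ∈ S}).toReal := by
      intro S hS
      rw [volume_eq_lintegral_volume_section hS.measurableSet]
      exact lintegral_congr fun t =>
        (ENNReal.ofReal_toReal (isCompact_section hS t).measure_lt_top.ne).symm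
    rw [heq hA, heq hB, heq hC]
    refine prekopa_leindler_real (measurable_volume_section hA.measurableSet)
      (measurable_volume_section hB.measurableSet) (measurable_volume_section hC.measurableSet)
      (fun _ => ENNReal.toReal_nonneg) (fun _ => ENNReal.toReal_nonneg)
      (fun _ => ENNReal.toReal_nonneg) (hbdd hA) (hbdd hB)
      (by rw [← heq hA]; exact hA.measure_lt_top.ne) (by rw [← heq hB]; exact hB.measure_lt_top.ne)
      hl0 hl1 fun x y => ?_
    rw [ENNReal.toReal_rpow, ENNReal.toReal_rpow, ← ENNReal.toReal_mul]
    refine ENNReal.toReal_mono (isCompact_section hC _).measure_lt_top.ne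
      (ih (isCompact_section hA x) (isCompact_section hB y) (isCompact_section hC _) hl0 hl1
        fun u hu v hv => ?_)
    have := h _ hu _ hv
    have e : (1 - l) • (Fin.cons x u : Fin (n + 1) → ℝ) + l • (Fin.cons y v : Fin (n + 1) → ℝ) =
        Fin.cons ((1 - l) * x + l * y) ((1 - l) • u + l • v) := by
      ext i
      refine Fin.cases ?_ (fun j => ?_) i <;> simp
    rwa [e] at this

theorem upperSemicontinuous_volume_section {n : ℕ} {S : Set (Fin (n + 1) → ℝ)}
    (hS : IsCompact S) :
    UpperSemicontinuous fun t : ℝ => (volume {y : Fin n → ℝ | Fin.cons t y ∈ S}).toReal := by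
  intro t b hb
  have hb' : (volume {y : Fin n → ℝ | Fin.cons t y ∈ S}).toReal < b := hb
  rw [← ENNReal.lt_ofReal_iff_toReal_lt (isCompact_section hS t).measure_lt_top.ne] at hb'
  obtain ⟨U, hSU, hU, hUb⟩ := Set.exists_isOpen_lt_of_lt _ _ hb'
  have hK : IsCompact ((fun x : Fin (n + 1) → ℝ => x 0) '' (S \ Fin.tail ⁻¹' U)) :=
    (hS.diff (hU.preimage (continuous_pi fun i => continuous_apply i.succ))).image
      (continuous_apply 0)
  have ht : t ∈ ((fun x : Fin (n + 1) → ℝ => x 0) '' (S \ Fin.tail ⁻¹' U))ᶜ := by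
    rintro ⟨x, ⟨hx, hxU⟩, rfl⟩
    exact hxU (hSU (by simpa using hx))
  filter_upwards [hK.isClosed.isOpen_compl.mem_nhds ht] with s hs
  rw [← ENNReal.lt_ofReal_iff_toReal_lt (isCompact_section hS s).measure_lt_top.ne]
  refine (measure_mono fun y hy => ?_).trans_lt hUb
  by_contra hyU
  exact hs ⟨Fin.cons s y, ⟨hy, by simpa using hyU⟩, by simp⟩

theorem integral_abs_log_sub_le_of_convex_pi {n : ℕ} {S : Set (Fin (n + 1) → ℝ)}
    (hS : IsCompact S) (hSc : Convex ℝ S) (hS0 : volume S ≠ 0) {Q : ℝ → ℝ} {c : ℝ} (hc : 1 ≤ c)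
    (hQc : Continuous Q) (hQpos : ∀ x, 0 < Q x)
    (hQ : ∀ a b v ε, v ∈ Set.Icc a b → 0 ≤ ε →
      volume {s ∈ Set.Icc a b | Q s ≤ ε * Q v} ≤ ENNReal.ofReal (c * ε * (b - a))) (a : ℝ) :
    ∫ x, max (|Real.log (Q (x 0)) - ∫ y, Real.log (Q (y 0)) ∂(ProbabilityTheory.cond volume S)|
      - a) 0 ∂(ProbabilityTheory.cond volume S) ≤ 4 * c * Real.exp (-a) := by
  have hSt : volume S ≠ ⊤ := hS.measure_lt_top.ne
  have hSpos : 0 < (volume S).toReal := ENNReal.toReal_pos hS0 hSt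
  set μ := ProbabilityTheory.cond volume S with hμ
  have : IsProbabilityMeasure μ := ProbabilityTheory.cond_isProbabilityMeasure_of_finite hS0 hSt
  have hπ : Measurable fun x : Fin (n + 1) → ℝ => x 0 := measurable_pi_apply 0
  set A : ℝ → ℝ := fun t => (volume {y : Fin n → ℝ | Fin.cons t y ∈ S}).toReal with hA
  have hAm : Measurable A := measurable_volume_section hS.measurableSet
  have hAsupp : Function.support A ⊆ (fun x : Fin (n + 1) → ℝ => x 0) '' S := fun t ht => by
    have : {y : Fin n → ℝ | Fin.cons t y ∈ S}.Nonempty := by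
      rw [Set.nonempty_iff_ne_empty]
      intro h
      simp [hA, h] at ht
    obtain ⟨y, hy⟩ := this
    exact ⟨_, hy, by simp⟩
  have hne : S.Nonempty := nonempty_of_measure_ne_zero hS0
  have hIm : IsCompact ((fun x : Fin (n + 1) → ℝ => x 0) '' S) := hS.image (continuous_apply 0)
  obtain ⟨x₀, -, hx₀⟩ := ((upperSemicontinuous_volume_section hS).upperSemicontinuousOn
    _).exists_isMaxOn (hne.image _) hIm
  have hmax : ∀ t, A t ≤ A x₀ := fun t => by
    by_cases ht : t ∈ (fun x : Fin (n + 1) → ℝ => x 0) '' S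
    · exact hx₀ ht
    · rw [Function.notMem_support.1 fun h => ht (hAsupp h)]
      exact ENNReal.toReal_nonneg
  have hAlc : ∀ x y l, l ∈ Set.Icc (0 : ℝ) 1 →
      A x ^ (1 - l) * A y ^ l ≤ A ((1 - l) * x + l * y) := by
    rintro x y l ⟨hl0, hl1⟩
    rcases hl0.eq_or_lt with rfl | hl0
    · simp
    rcases hl1.eq_or_lt with rfl | hl1
    · simp
    simp only [hA]
    rw [ENNReal.toReal_rpow, ENNReal.toReal_rpow, ← ENNReal.toReal_mul]
    refine ENNReal.toReal_mono (isCompact_section hS _).measure_lt_top.ne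
      (brunn_minkowski_multiplicative (isCompact_section hS x) (isCompact_section hS y)
        (isCompact_section hS _) hl0 hl1 fun u hu v hv => ?_)
    have := hSc hu hv (by linarith : 0 ≤ 1 - l) hl0.le (by ring)
    have e : (1 - l) • (Fin.cons x u : Fin (n + 1) → ℝ) + l • (Fin.cons y v : Fin (n + 1) → ℝ) =
        Fin.cons ((1 - l) * x + l * y) ((1 - l) • u + l • v) := by
      ext i
      refine Fin.cases ?_ (fun j => ?_) i <;> simp
    rwa [e] at this
  have hV0 : 0 ≤ (volume S).toReal⁻¹ := by positivity
  have hρ : μ.map (fun x => x 0) =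
      volume.withDensity fun t => ENNReal.ofReal ((volume S).toReal⁻¹ * A t) := by
    ext U hU
    rw [Measure.map_apply hπ hU, hμ, ProbabilityTheory.cond_apply hS.measurableSet,
      withDensity_apply _ hU, volume_eq_lintegral_volume_section
        (hS.measurableSet.inter (hπ hU)), ← lintegral_indicator hU,
      ← lintegral_const_mul' _ _ (ENNReal.inv_ne_top.2 hS0)]
    refine lintegral_congr fun t => ?_
    by_cases ht : t ∈ U
    · rw [Set.indicator_of_mem ht, ENNReal.ofReal_mul hV0, ENNReal.ofReal_inv_of_pos hSpos,
        ENNReal.ofReal_toReal hSt, ENNReal.ofReal_toReal (isCompact_section hS t).measure_lt_top.ne]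
      simp [ht]
    · rw [Set.indicator_of_notMem ht]
      simp [ht]
  have hρp : IsProbabilityMeasure (μ.map fun x => x 0) :=
    Measure.isProbabilityMeasure_map hπ.aemeasurable
  have hAb : Bornology.IsBounded (Function.support fun t => (volume S).toReal⁻¹ * A t) :=
    hIm.isBounded.subset ((Function.support_mul_subset_right _ _).trans hAsupp)
  have main := integral_abs_log_sub_le_of_logConcave hc hQc hQpos hQ
    (w := fun t => (volume S).toReal⁻¹ * A t) (hAm.const_mul _)
    (fun t => mul_nonneg hV0 ENNReal.toReal_nonneg) hAb
    (x₀ := x₀) (fun t => mul_le_mul_of_nonneg_left (hmax t) hV0) (fun x y l hl => by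
      rw [Real.mul_rpow hV0 ENNReal.toReal_nonneg, Real.mul_rpow hV0 ENNReal.toReal_nonneg,
        mul_mul_mul_comm, ← Real.rpow_add (by positivity), sub_add_cancel, Real.rpow_one]
      exact mul_le_mul_of_nonneg_left (hAlc x y l hl) hV0) hρ a
  have hlog : Continuous fun t => Real.log (Q t) := hQc.log fun x => (hQpos x).ne'
  rw [integral_map hπ.aemeasurable hlog.aestronglyMeasurable,
    integral_map hπ.aemeasurable
      (by fun_prop : Continuous _).aestronglyMeasurable] at main
  exact main

section Localization

variable {ι : Type*} [Fintype ι]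

/-- The bodies occurring in the localization argument. -/
def IsNeedleBody (F : Set (ι → ℝ)) (u v : (ι → ℝ) → ℝ) (A : Set (ι → ℝ)) : Prop :=
  IsCompact A ∧ Convex ℝ A ∧ A ⊆ F ∧ volume A ≠ 0 ∧ ∫ x in A, u x = 0 ∧ 0 < ∫ x in A, v x

/-- Compact convex sets all of whose neighbourhoods contain a body as in `IsNeedleBody`. -/
def IsNeedleLimit (F : Set (ι → ℝ)) (u v : (ι → ℝ) → ℝ) (K : Set (ι → ℝ)) : Prop :=
  IsCompact K ∧ Convex ℝ K ∧ ∀ U, IsOpen U → K ⊆ U → ∃ A ⊆ U, IsNeedleBody F u v A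

variable {F : Set (ι → ℝ)} {u v : (ι → ℝ) → ℝ}

theorem exists_minimal_isNeedleLimit {K : Set (ι → ℝ)} (hK : IsNeedleLimit F u v K) :
    ∃ L ⊆ K, Minimal (IsNeedleLimit F u v) L := by
  refine zorn_superset_nonempty {L | IsNeedleLimit F u v L} (fun C hC hchain hne => ?_) K hK
  have : Nonempty C := hne.to_subtype
  refine ⟨⋂₀ C, ⟨?_, ?_, fun U hU hCU => ?_⟩, fun s hs => Set.sInter_subset_of_mem hs⟩
  · obtain ⟨s, hs⟩ := hne
    exact (hC hs).1.of_isClosed_subset (isClosed_sInter fun t ht => (hC ht).1.isClosed)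
      (Set.sInter_subset_of_mem hs)
  · exact convex_sInter fun s hs => (hC hs).2.1
  · obtain ⟨s, hs⟩ := exists_subset_nhds_of_isCompact' (V := fun s : C => (s : Set (ι → ℝ)))
      (fun s t => (hchain.total s.2 t.2).elim (fun h => ⟨s, subset_rfl, h⟩)
        fun h => ⟨t, h, subset_rfl⟩) (fun s => (hC s.2).1)
      (fun s => (hC s.2).1.isClosed) (U := U) (fun x hx => hU.mem_nhds (hCU (by
        rwa [Set.sInter_eq_iInter])))
    exact (hC s.2).2.2 U hU hs

theorem convex_halfspace_dotProduct (w c : ι → ℝ) : Convex ℝ {x | w ⬝ᵥ (x - c) ≤ 0} := by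
  intro x hx y hy p q hp hq hpq
  have hx' : w ⬝ᵥ (x - c) ≤ 0 := hx
  have hy' : w ⬝ᵥ (y - c) ≤ 0 := hy
  change w ⬝ᵥ (p • x + q • y - c) ≤ 0
  have : p • x + q • y - c = p • (x - c) + q • (y - c) := by
    rw [smul_sub, smul_sub, sub_add_sub_comm, ← add_smul, hpq, one_smul]
  rw [this, dotProduct_add, dotProduct_smul, dotProduct_smul]
  exact add_nonpos (mul_nonpos_of_nonneg_of_nonpos hp hx') (mul_nonpos_of_nonneg_of_nonpos hq hy')

theorem volume_hyperplane_eq_zero {w : ι → ℝ} (hw : w ≠ 0) (c : ι → ℝ) :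
    volume {x | w ⬝ᵥ (x - c) = 0} = 0 := by
  let s : Submodule ℝ (ι → ℝ) := LinearMap.ker (dotProductBilin ℝ ℝ w)
  have hs : s ≠ ⊤ := fun h => by
    have : w ∈ s := h ▸ Submodule.mem_top
    exact hw (dotProduct_self_eq_zero.1 (LinearMap.mem_ker.1 this))
  have h := Measure.addHaar_submodule volume s hs
  have e : {x | w ⬝ᵥ (x - c) = 0} = (fun x => x - c) ⁻¹' (s : Set (ι → ℝ)) := rfl
  rw [e]
  simp only [sub_eq_add_neg]
  rw [measure_preimage_add_right, h]

theorem continuous_setIntegral_halfspace {A : Set (ι → ℝ)} (hA : IsCompact A)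
    (hu : Continuous u) {w : ℝ → ι → ℝ} (hw : Continuous w) (hw0 : ∀ θ, w θ ≠ 0) (c : ι → ℝ) :
    Continuous fun θ => ∫ x in A ∩ {x | w θ ⬝ᵥ (x - c) ≤ 0}, u x := by
  have hm : ∀ θ, MeasurableSet {x | w θ ⬝ᵥ (x - c) ≤ 0} := fun θ =>
    (isClosed_le (by fun_prop) continuous_const).measurableSet
  have e : (fun θ => ∫ x in A ∩ {x | w θ ⬝ᵥ (x - c) ≤ 0}, u x) =
      fun θ => ∫ x in A, {x | w θ ⬝ᵥ (x - c) ≤ 0}.indicator u x := by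
    ext θ
    rw [integral_indicator (hm θ), Measure.restrict_restrict (hm θ), Set.inter_comm]
  rw [e, continuous_iff_continuousAt]
  intro θ₀
  refine continuousAt_of_dominated (bound := fun x => ‖u x‖)
    (Filter.Eventually.of_forall fun θ => (hu.measurable.indicator (hm θ)).aestronglyMeasurable)
    (Filter.Eventually.of_forall fun θ => Filter.Eventually.of_forall fun x =>
      norm_indicator_le_norm_self _ _) (hu.continuousOn.integrableOn_compact hA).norm ?_
  have hnull : ∀ᵐ x ∂(volume.restrict A), w θ₀ ⬝ᵥ (x - c) ≠ 0 :=
    ae_restrict_of_ae (measure_eq_zero_iff_ae_notMem.1 (volume_hyperplane_eq_zero (hw0 θ₀) c))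
  filter_upwards [hnull] with x hx
  have hcont : Continuous fun θ => w θ ⬝ᵥ (x - c) := by fun_prop
  rcases lt_or_gt_of_ne hx with h | h
  · refine (continuousAt_const (y := u x)).congr ?_
    filter_upwards [hcont.continuousAt.eventually_lt_const h] with θ hθ
    exact (Set.indicator_of_mem (s := {x | w θ ⬝ᵥ (x - c) ≤ 0}) hθ.le u).symm
  · refine (continuousAt_const (y := (0 : ℝ))).congr ?_
    filter_upwards [hcont.continuousAt.eventually_const_lt h] with θ hθ
    exact (Set.indicator_of_notMem (s := {x | w θ ⬝ᵥ (x - c) ≤ 0}) (not_le.2 hθ) u).symm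

theorem exists_isNeedleBody_subset_halfspace (hu : Continuous u) (hv : Continuous v)
    {A : Set (ι → ℝ)} (hA : IsNeedleBody F u v A) {v₁ v₂ : ι → ℝ}
    (hw0 : ∀ θ : ℝ, Real.cos θ • v₁ + Real.sin θ • v₂ ≠ 0) (c : ι → ℝ) :
    ∃ θ ∈ Set.Icc 0 (2 * Real.pi), IsNeedleBody F u v
      (A ∩ {x | (Real.cos θ • v₁ + Real.sin θ • v₂) ⬝ᵥ (x - c) ≤ 0}) := by
  obtain ⟨hAc, hAconv, hAF, hAvol, hAu, hAv⟩ := hA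
  set w : ℝ → ι → ℝ := fun θ => Real.cos θ • v₁ + Real.sin θ • v₂ with hwdef
  have hw : Continuous w := by fun_prop
  have hwπ : ∀ θ, w (θ + Real.pi) = - w θ := fun θ => by
    simp [hwdef, add_comm]
  have hclosed : ∀ θ, IsClosed {x | w θ ⬝ᵥ (x - c) ≤ 0} := fun θ =>
    isClosed_le (by fun_prop) continuous_const
  have hadd : ∀ g : (ι → ℝ) → ℝ, Continuous g → ∀ θ,
      (∫ x in A ∩ {x | w θ ⬝ᵥ (x - c) ≤ 0}, g x) +
        ∫ x in A ∩ {x | w (θ + Real.pi) ⬝ᵥ (x - c) ≤ 0}, g x = ∫ x in A, g x := fun g hg θ => by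
    have hgi := hg.continuousOn.integrableOn_compact (μ := volume) hAc
    rw [← integral_inter_add_sdiff (hclosed θ).measurableSet hgi]
    congr 1
    refine setIntegral_congr_set ?_
    have := measure_eq_zero_iff_ae_notMem.1 (volume_hyperplane_eq_zero (hw0 θ) c)
    filter_upwards [this] with x hx
    have hx' : w θ ⬝ᵥ (x - c) ≠ 0 := hx
    refine propext (and_congr_right fun _ => ?_)
    change w (θ + Real.pi) ⬝ᵥ (x - c) ≤ 0 ↔ ¬ (w θ ⬝ᵥ (x - c) ≤ 0)
    rw [hwπ, neg_dotProduct, neg_nonpos, not_le]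
    exact ⟨fun h => lt_of_le_of_ne h hx'.symm, le_of_lt⟩
  have hcont := continuous_setIntegral_halfspace hAc hu hw hw0 c
  obtain ⟨θ, hθ, hθ0⟩ : ∃ θ ∈ Set.Icc 0 Real.pi,
      ∫ x in A ∩ {x | w θ ⬝ᵥ (x - c) ≤ 0}, u x = 0 := by
    have h0 := hadd u hu 0
    rw [zero_add, hAu] at h0
    have := intermediate_value_uIcc (a := 0) (b := Real.pi) hcont.continuousOn
    have hmem : (0 : ℝ) ∈ Set.uIcc (∫ x in A ∩ {x | w 0 ⬝ᵥ (x - c) ≤ 0}, u x)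
        (∫ x in A ∩ {x | w Real.pi ⬝ᵥ (x - c) ≤ 0}, u x) := by
      rw [Set.mem_uIcc]
      by_contra! hh
      rcases le_total (∫ x in A ∩ {x | w 0 ⬝ᵥ (x - c) ≤ 0}, u x) 0 with h | h
      · linarith [hh.1 h]
      · have := hh.2 (by linarith)
        linarith
    obtain ⟨θ, hθ, h⟩ := this hmem
    rw [Set.uIcc_of_le Real.pi_pos.le] at hθ
    exact ⟨θ, hθ, h⟩
  have hbody : ∀ θ, ∫ x in A ∩ {x | w θ ⬝ᵥ (x - c) ≤ 0}, u x = 0 →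
      0 < ∫ x in A ∩ {x | w θ ⬝ᵥ (x - c) ≤ 0}, v x →
      IsNeedleBody F u v (A ∩ {x | w θ ⬝ᵥ (x - c) ≤ 0}) := fun θ h1 h2 => by
    refine ⟨hAc.inter_right (hclosed θ), hAconv.inter (convex_halfspace_dotProduct _ _),
      Set.inter_subset_left.trans hAF,
      fun h0 => ?_, h1, h2⟩
    rw [setIntegral_measure_zero _ h0] at h2
    exact lt_irrefl _ h2
  have hv' := hadd v hv θ
  have hu' := hadd u hu θ
  rw [hθ0, hAu, zero_add] at hu'
  by_cases h : 0 < ∫ x in A ∩ {x | w θ ⬝ᵥ (x - c) ≤ 0}, v x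
  · exact ⟨θ, ⟨hθ.1, by linarith [hθ.2, Real.pi_pos]⟩, hbody θ hθ0 h⟩
  · exact ⟨θ + Real.pi, ⟨by linarith [hθ.1, Real.pi_pos], by linarith [hθ.2]⟩,
      hbody _ hu' (by linarith)⟩

theorem collinear_of_minimal_isNeedleLimit (hu : Continuous u) (hv : Continuous v)
    {K : Set (ι → ℝ)} (hK : Minimal (IsNeedleLimit F u v) K) {p₀ : ι → ℝ} (hp₀ : p₀ ∈ K) :
    Collinear ℝ K := by
  by_contra hcol
  rw [collinear_iff_of_mem hp₀] at hcol
  push Not at hcol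
  obtain ⟨p₁, hp₁, h₁⟩ := hcol 0
  obtain ⟨p₂, hp₂, h₂⟩ := hcol (p₁ - p₀)
  have hv₁ : p₁ - p₀ ≠ 0 := fun h => h₁ 0 (by simpa using sub_eq_zero.1 h)
  set v₁ := p₁ - p₀ with hv₁def
  set v₂ := p₂ - p₀ with hv₂def
  have hind : ∀ a b : ℝ, a • v₁ + b • v₂ = 0 → a = 0 ∧ b = 0 := by
    intro a b hab
    by_cases hb : b = 0
    · subst hb
      simp only [zero_smul, add_zero, smul_eq_zero, hv₁, or_false] at hab
      exact ⟨hab, rfl⟩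
    · exfalso
      refine h₂ (-a / b) ?_
      have : v₂ = (-a / b) • v₁ := by
        have h3 : b • v₂ = (-a) • v₁ := by
          rw [neg_smul]; exact eq_neg_of_add_eq_zero_right hab
        rw [div_eq_inv_mul, mul_smul, ← h3, smul_smul, inv_mul_cancel₀ hb, one_smul]
      rw [vadd_eq_add, ← this, hv₂def, sub_add_cancel]
  have hw0 : ∀ θ : ℝ, Real.cos θ • v₁ + Real.sin θ • v₂ ≠ 0 := fun θ h => by
    obtain ⟨h1, h2⟩ := hind _ _ h
    have := Real.sin_sq_add_cos_sq θ
    rw [h1, h2] at this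
    norm_num at this
  set c : ι → ℝ := (3 : ℝ)⁻¹ • (p₀ + p₁ + p₂) with hc
  set w : ℝ → ι → ℝ := fun θ => Real.cos θ • v₁ + Real.sin θ • v₂ with hwdef
  have hw : Continuous w := by fun_prop
  have hproper : ∀ θ, ∃ p ∈ K, 0 < w θ ⬝ᵥ (p - c) := by
    intro θ
    by_contra! hneg
    have e0 := hneg p₀ hp₀
    have e1 := hneg p₁ hp₁
    have e2 := hneg p₂ hp₂
    have hsum : w θ ⬝ᵥ (p₀ - c) + w θ ⬝ᵥ (p₁ - c) + w θ ⬝ᵥ (p₂ - c) = 0 := by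
      rw [← dotProduct_add, ← dotProduct_add]
      have : p₀ - c + (p₁ - c) + (p₂ - c) = 0 := by
        ext i; simp [hc]; ring
      rw [this, dotProduct_zero]
    have d1 : w θ ⬝ᵥ v₁ = 0 := by
      have : v₁ = (p₁ - c) - (p₀ - c) := by rw [hv₁def]; abel
      rw [this, dotProduct_sub]; linarith
    have d2 : w θ ⬝ᵥ v₂ = 0 := by
      have : v₂ = (p₂ - c) - (p₀ - c) := by rw [hv₂def]; abel
      rw [this, dotProduct_sub]; linarith
    have : w θ ⬝ᵥ w θ = 0 := by
      conv_lhs => rw [hwdef]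
      change w θ ⬝ᵥ (Real.cos θ • v₁ + Real.sin θ • v₂) = 0
      rw [dotProduct_add, dotProduct_smul, dotProduct_smul, d1, d2]; simp
    exact hw0 θ (dotProduct_self_eq_zero.1 this)
  have hclosed : ∀ θ, IsClosed {x | w θ ⬝ᵥ (x - c) ≤ 0} := fun θ =>
    isClosed_le (by fun_prop) continuous_const
  have hloc : ∀ θ, ∃ V ∈ nhds θ, ∃ W, IsOpen W ∧ K ⊆ W ∧ ∀ θ' ∈ V, ∀ A,
      IsNeedleBody F u v A → ¬ A ⊆ W ∩ {x | w θ' ⬝ᵥ (x - c) ≤ 0} := by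
    intro θ
    have hnot : ¬ IsNeedleLimit F u v (K ∩ {x | w θ ⬝ᵥ (x - c) ≤ 0}) := fun h => by
      obtain ⟨p, hp, hpos⟩ := hproper θ
      exact absurd (hK.2 h Set.inter_subset_left hp).2 (not_le.2 hpos)
    have hconv : Convex ℝ (K ∩ {x | w θ ⬝ᵥ (x - c) ≤ 0}) :=
      hK.1.2.1.inter (convex_halfspace_dotProduct _ _)
    have : ∃ U, IsOpen U ∧ K ∩ {x | w θ ⬝ᵥ (x - c) ≤ 0} ⊆ U ∧ ∀ A ⊆ U, ¬ IsNeedleBody F u v A := by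
      by_contra! hh
      exact hnot ⟨hK.1.1.inter_right (hclosed θ), hconv, hh⟩
    obtain ⟨U, hU, hKU, hUA⟩ := this
    have hO : IsOpen {q : ℝ × (ι → ℝ) | q.2 ∈ U ∨ 0 < w q.1 ⬝ᵥ (q.2 - c)} :=
      (hU.preimage continuous_snd).union (isOpen_lt continuous_const
        ((hw.comp continuous_fst).dotProduct (continuous_snd.sub continuous_const)))
    obtain ⟨V, W, hV, hW, hθV, hKW, hVW⟩ := generalized_tube_lemma (isCompact_singleton (x := θ))
      hK.1.1 hO (by
        rintro ⟨θ', x⟩ ⟨hθ', hx⟩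
        rw [Set.mem_singleton_iff] at hθ'
        dsimp only at hθ' hx
        subst hθ'
        by_cases h : 0 < w θ' ⬝ᵥ (x - c)
        · exact Or.inr h
        · exact Or.inl (hKU ⟨hx, not_lt.1 h⟩))
    refine ⟨V, hV.mem_nhds (hθV rfl), W, hW, hKW, fun θ' hθ' A hA hAW => hUA A (fun x hx => ?_) hA⟩
    rcases hVW (Set.mk_mem_prod hθ' (hAW hx).1) with h | h
    · exact h
    · exact absurd (hAW hx).2 (not_le.2 h)
  choose V hV W hW hKW hVW using hloc
  obtain ⟨t, -, ht⟩ := (isCompact_Icc (a := (0 : ℝ)) (b := 2 * Real.pi)).elim_nhds_subcover V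
    fun θ _ => hV θ
  obtain ⟨A, hAW, hA⟩ := hK.1.2.2 (⋂ θ ∈ t, W θ) (isOpen_biInter_finset fun θ _ => hW θ)
    (Set.subset_iInter₂ fun θ _ => hKW θ)
  obtain ⟨θ, hθ, hbody⟩ := exists_isNeedleBody_subset_halfspace hu hv hA hw0 c
  obtain ⟨θ₀, hθ₀, hθV⟩ := Set.mem_iUnion₂.1 (ht hθ)
  refine hVW θ₀ θ hθV _ hbody fun x hx => ⟨?_, hx.2⟩
  exact Set.mem_iInter₂.1 (hAW hx.1) θ₀ hθ₀

theorem exists_collinear_isNeedleLimit (hu : Continuous u) (hv : Continuous v)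
    (hF : IsNeedleBody F u v F) : ∃ K, K.Nonempty ∧ Collinear ℝ K ∧ IsNeedleLimit F u v K := by
  obtain ⟨K, -, hK⟩ := exists_minimal_isNeedleLimit (K := F)
    ⟨hF.1, hF.2.1, fun U _ hFU => ⟨F, hFU, hF⟩⟩
  have hne : K.Nonempty := by
    rw [Set.nonempty_iff_ne_empty]
    rintro rfl
    obtain ⟨A, hA, hb⟩ := hK.1.2.2 ∅ isOpen_empty (Set.empty_subset _)
    exact hb.2.2.2.1 (by rw [Set.subset_empty_iff.1 hA, measure_empty])
  obtain ⟨p, hp⟩ := hne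
  exact ⟨K, ⟨p, hp⟩, collinear_of_minimal_isNeedleLimit hu hv hK hp, hK.1⟩

end Localization

theorem integral_abs_log_sub_le_of_convex_pi_apply {n : ℕ} {S : Set (Fin (n + 1) → ℝ)}
    (hS : IsCompact S) (hSc : Convex ℝ S) (hS0 : volume S ≠ 0) {Q : ℝ → ℝ} {c : ℝ} (hc : 1 ≤ c)
    (hQc : Continuous Q) (hQpos : ∀ x, 0 < Q x)
    (hQ : ∀ a b v ε, v ∈ Set.Icc a b → 0 ≤ ε →
      volume {s ∈ Set.Icc a b | Q s ≤ ε * Q v} ≤ ENNReal.ofReal (c * ε * (b - a)))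
    (j : Fin (n + 1)) (a : ℝ) :
    ∫ x, max (|Real.log (Q (x j)) - ∫ y, Real.log (Q (y j)) ∂(ProbabilityTheory.cond volume S)|
      - a) 0 ∂(ProbabilityTheory.cond volume S) ≤ 4 * c * Real.exp (-a) := by
  let T := MeasurableEquiv.piCongrLeft (fun _ : Fin (n + 1) => ℝ) (Equiv.swap 0 j)
  have hTm : MeasurePreserving T volume volume :=
    volume_measurePreserving_piCongrLeft (fun _ : Fin (n + 1) => ℝ) (Equiv.swap 0 j)
  have hT : ∀ x i, T x i = x (Equiv.swap 0 j i) := fun x i => by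
    have := Equiv.piCongrLeft_apply_apply (fun _ : Fin (n + 1) => ℝ) (Equiv.swap 0 j) x
      (Equiv.swap 0 j i)
    simpa only [T, MeasurableEquiv.coe_piCongrLeft, Equiv.swap_apply_self] using this
  have hTc : Continuous T := continuous_pi fun i => by
    simp only [hT]; exact continuous_apply _
  have hTT : ∀ x, T (T x) = x := fun x => by ext i; simp [hT]
  have hTS : T ⁻¹' S = T '' S := by
    ext x
    exact ⟨fun h => ⟨T x, h, hTT x⟩, by rintro ⟨y, hy, rfl⟩; simpa [hTT] using hy⟩
  have hmap : (ProbabilityTheory.cond volume (T ⁻¹' S)).map T =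
      ProbabilityTheory.cond volume S := by
    ext U hU
    rw [Measure.map_apply T.measurable hU,
      ProbabilityTheory.cond_apply (T.measurable hS.measurableSet),
      ProbabilityTheory.cond_apply hS.measurableSet, ← Set.preimage_inter,
      hTm.measure_preimage hS.measurableSet.nullMeasurableSet,
      hTm.measure_preimage (hS.measurableSet.inter hU).nullMeasurableSet]
  have hlin : IsLinearMap ℝ T := ⟨fun x y => by ext i; simp [hT], fun r x => by ext i; simp [hT]⟩
  have main := integral_abs_log_sub_le_of_convex_pi (S := T ⁻¹' S)
    (by rw [hTS]; exact hS.image hTc) (hSc.is_linear_preimage hlin)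
    (by rwa [hTm.measure_preimage hS.measurableSet.nullMeasurableSet]) hc hQc hQpos hQ a
  have h0 : ∀ x, x 0 = T x j := fun x => by simp [hT]
  simp only [h0] at main
  rw [← hmap, integral_map_equiv, integral_map_equiv]
  exact main

theorem integral_cond_eq {n : ℕ} (A : Set (Fin n → ℝ)) (f : (Fin n → ℝ) → ℝ) :
    ∫ x, f x ∂(ProbabilityTheory.cond volume A) = (volume A).toReal⁻¹ * ∫ x in A, f x := by
  rw [ProbabilityTheory.cond, integral_smul_measure, ENNReal.toReal_inv, smul_eq_mul]

theorem exists_line_coordinate {n : ℕ} {K : Set (Fin (n + 1) → ℝ)} (hK : Collinear ℝ K) :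
    ∃ (j : Fin (n + 1)) (p e : Fin (n + 1) → ℝ), ∀ x ∈ K, x = p + x j • e := by
  obtain ⟨p₀, v, hv⟩ := (collinear_iff_exists_forall_eq_smul_vadd (k := ℝ) K).1 hK
  by_cases h : v = 0
  · refine ⟨0, p₀ - p₀ 0 • Pi.single 0 1, Pi.single 0 1, fun x hx => ?_⟩
    obtain ⟨r, rfl⟩ := hv x hx
    simp [h]
  · obtain ⟨j, hj⟩ := Function.ne_iff.1 h
    have hj' : v j ≠ 0 := hj
    refine ⟨j, p₀ - (p₀ j / v j) • v, (v j)⁻¹ • v, fun x hx => ?_⟩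
    obtain ⟨r, rfl⟩ := hv x hx
    ext i
    simp only [vadd_eq_add, Pi.add_apply, Pi.smul_apply, smul_eq_mul, Pi.sub_apply]
    field_simp
    ring

/-- Dimension-free concentration of `log Q` on a convex body. -/
theorem integral_abs_log_sub_le_of_convex {n : ℕ} {F : Set (Fin n → ℝ)}
    (hF : IsCompact F) (hFc : Convex ℝ F) (hF0 : volume F ≠ 0) {Q : (Fin n → ℝ) → ℝ} {c : ℝ}
    (hc : 1 ≤ c) (hQc : Continuous Q) (hQpos : ∀ x, 0 < Q x)
    (hQ : ∀ (p e : Fin n → ℝ) (a b v ε : ℝ), v ∈ Set.Icc a b → 0 ≤ ε →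
      volume {s ∈ Set.Icc a b | Q (p + s • e) ≤ ε * Q (p + v • e)} ≤
        ENNReal.ofReal (c * ε * (b - a))) (a : ℝ) :
    ∫ x, max (|Real.log (Q x) - ∫ y, Real.log (Q y) ∂(ProbabilityTheory.cond volume F)|
      - a) 0 ∂(ProbabilityTheory.cond volume F) ≤ 4 * c * Real.exp (-a) := by
  have hlogc : Continuous fun x => Real.log (Q x) := hQc.log fun x => (hQpos x).ne'
  have hprob : ∀ A : Set (Fin n → ℝ), IsCompact A → volume A ≠ 0 →
      IsProbabilityMeasure (ProbabilityTheory.cond volume A) := fun A hA hA0 =>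
    ProbabilityTheory.cond_isProbabilityMeasure_of_finite hA0 hA.measure_lt_top.ne
  have hint : ∀ A : Set (Fin n → ℝ), IsCompact A → volume A ≠ 0 → ∀ f : (Fin n → ℝ) → ℝ,
      Continuous f → Integrable f (ProbabilityTheory.cond volume A) := fun A hA hA0 f hf =>
    (hf.continuousOn.integrableOn_compact hA).smul_measure (ENNReal.inv_ne_top.2 hA0)
  have := hprob F hF hF0
  set m := ∫ y, Real.log (Q y) ∂(ProbabilityTheory.cond volume F) with hm
  rcases n with _ | n
  · have hsub : ∀ x : Fin 0 → ℝ, Real.log (Q x) = Real.log (Q 0) := fun x => by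
      rw [Subsingleton.elim x 0]
    have hm' : m = Real.log (Q 0) := by
      rw [hm, integral_congr_ae (Filter.Eventually.of_forall hsub)]
      simp
    simp only [hsub, hm', sub_self, abs_zero, zero_sub, integral_const, probReal_univ, smul_eq_mul,
      one_mul]
    refine max_le ?_ (by positivity)
    nlinarith [Real.add_one_le_exp (-a), Real.exp_pos (-a)]
  by_contra! hcon
  obtain ⟨K', hK0, hK1⟩ := exists_between hcon
  have hΦ : Continuous fun x => max (|Real.log (Q x) - m| - a) 0 := by fun_prop
  have hconst : ∀ A : Set (Fin (n + 1) → ℝ), IsCompact A → volume A ≠ 0 → ∀ f : _ → ℝ,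
      Continuous f → ∀ k, ∫ x, (f x - k) ∂(ProbabilityTheory.cond volume A) =
        ∫ x, f x ∂(ProbabilityTheory.cond volume A) - k := fun A hA hA0 f hf k => by
    have := hprob A hA hA0
    rw [integral_sub (hint A hA hA0 f hf) (integrable_const k)]; simp
  have hpos : ∀ A : Set (Fin (n + 1) → ℝ), IsCompact A → volume A ≠ 0 →
      0 < (volume A).toReal⁻¹ := fun A hA hA0 =>
    inv_pos.2 (ENNReal.toReal_pos hA0 hA.measure_lt_top.ne)
  have hbody : IsNeedleBody F (fun x => Real.log (Q x) - m)
      (fun x => max (|Real.log (Q x) - m| - a) 0 - K') F := by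
    refine ⟨hF, hFc, subset_rfl, hF0, ?_, ?_⟩
    · have h := hconst F hF hF0 _ hlogc m
      rw [← hm, sub_self, integral_cond_eq] at h
      exact (mul_eq_zero.1 h).resolve_left (hpos F hF hF0).ne'
    · have h := hconst F hF hF0 _ hΦ K'
      rw [integral_cond_eq] at h
      exact pos_of_mul_pos_right (h ▸ sub_pos.2 hK1) (hpos F hF hF0).le
  obtain ⟨K, hKne, hKcol, -, -, hKlim⟩ := exists_collinear_isNeedleLimit
    (u := fun x => Real.log (Q x) - m) (v := fun x => max (|Real.log (Q x) - m| - a) 0 - K')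
    (hlogc.sub continuous_const) (hΦ.sub continuous_const) hbody
  obtain ⟨j, p, e, hpe⟩ := exists_line_coordinate hKcol
  have hQ'c : Continuous fun t : ℝ => Q (p + t • e) := hQc.comp (by fun_prop)
  have hlogc' : Continuous fun x : Fin (n + 1) → ℝ => Real.log (Q (p + x j • e)) :=
    (hQ'c.log fun x => (hQpos _).ne').comp (continuous_apply j)
  set ε := (K' - 4 * c * Real.exp (-a)) / 2 with hε
  have hε0 : 0 < ε := by rw [hε]; linarith
  obtain ⟨A, hAU, hA, hAc, -, hA0, hAu, hAv⟩ := hKlim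
    {x | |Real.log (Q x) - Real.log (Q (p + x j • e))| < ε}
    (isOpen_lt (hlogc.sub hlogc').abs continuous_const) fun x hx => by
      change |Real.log (Q x) - Real.log (Q (p + x j • e))| < ε
      rw [← hpe x hx, sub_self, abs_zero]
      exact hε0
  have := hprob A hA hA0
  set η := ProbabilityTheory.cond volume A with hη
  have hu : ∫ x, Real.log (Q x) ∂η = m := by
    have h := hconst A hA hA0 _ hlogc m
    rw [integral_cond_eq, hAu, mul_zero] at h
    linarith
  have hv : K' < ∫ x, max (|Real.log (Q x) - m| - a) 0 ∂η := by
    have h := hconst A hA hA0 _ hΦ K'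
    rw [integral_cond_eq] at h
    have := mul_pos (hpos A hA hA0) hAv
    linarith
  have hE := integral_abs_log_sub_le_of_convex_pi_apply hA hAc hA0 hc hQ'c (fun t => hQpos _)
    (hQ p e) j a
  rw [← hη] at hE
  set m' := ∫ y, Real.log (Q (p + y j • e)) ∂η with hm'
  have hAe : ∀ᵐ x ∂η, |Real.log (Q x) - Real.log (Q (p + x j • e))| < ε := by
    have : ∀ᵐ x ∂η, x ∈ A := by
      rw [hη, ProbabilityTheory.cond]
      exact Measure.ae_smul_measure (ae_restrict_mem hA.measurableSet) _
    filter_upwards [this] with x hx using hAU hx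
  have hmm : |m - m'| ≤ ε := by
    rw [← hu, hm', ← integral_sub (hint A hA hA0 _ hlogc) (hint A hA hA0 _ hlogc')]
    have := norm_integral_le_of_norm_le_const (μ := η) (C := ε)
      (f := fun x => Real.log (Q x) - Real.log (Q (p + x j • e)))
      (hAe.mono fun x hx => by rw [Real.norm_eq_abs]; exact hx.le)
    simpa using this
  have hΦ' : Continuous fun x : Fin (n + 1) → ℝ =>
      max (|Real.log (Q (p + x j • e)) - m'| - a) 0 := by fun_prop
  have hle : ∫ x, max (|Real.log (Q x) - m| - a) 0 ∂η ≤
      ∫ x, (max (|Real.log (Q (p + x j • e)) - m'| - a) 0 + 2 * ε) ∂η := by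
    refine integral_mono_ae (hint A hA hA0 _ hΦ) (hint A hA hA0 _ (hΦ'.add continuous_const)) ?_
    filter_upwards [hAe] with x hx
    have h1 : |Real.log (Q x) - m| ≤ |Real.log (Q (p + x j • e)) - m'| + 2 * ε := by
      have h3 : Real.log (Q x) - m = (Real.log (Q (p + x j • e)) - m') +
        ((Real.log (Q x) - Real.log (Q (p + x j • e))) - (m - m')) := by ring
      rw [h3]
      refine (abs_add_le _ _).trans (add_le_add_right ((abs_sub _ _).trans ?_) _)
      linarith
    refine max_le ?_ ?_
    · linarith [le_max_left (|Real.log (Q (p + x j • e)) - m'| - a) 0]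
    · linarith [le_max_right (|Real.log (Q (p + x j • e)) - m'| - a) 0]
  rw [integral_add (hint A hA hA0 _ hΦ') (integrable_const _)] at hle
  simp only [integral_const, probReal_univ, smul_eq_mul, one_mul] at hle
  linarith

theorem integrable_of_tendsto_of_integral_le {X : Type*} [MeasurableSpace X] {μ : Measure X}
    {f : ℕ → X → ℝ} {g : X → ℝ} {C : ℝ} (hf : ∀ k, Integrable (f k) μ)
    (hf0 : ∀ k x, 0 ≤ f k x) (hC : ∀ k, ∫ x, f k x ∂μ ≤ C)
    (hlim : ∀ᵐ x ∂μ, Filter.Tendsto (fun k => f k x) Filter.atTop (nhds (g x))) :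
    Integrable g μ ∧ ∫ x, g x ∂μ ≤ C := by
  have hgm : AEStronglyMeasurable g μ :=
    aestronglyMeasurable_of_tendsto_ae _ (fun k => (hf k).aestronglyMeasurable) hlim
  have hg0 : 0 ≤ᵐ[μ] g := by
    filter_upwards [hlim] with x hx using ge_of_tendsto' hx fun k => hf0 k x
  have hle : ∫⁻ x, ENNReal.ofReal (g x) ∂μ ≤ ENNReal.ofReal C := by
    calc ∫⁻ x, ENNReal.ofReal (g x) ∂μ
        = ∫⁻ x, Filter.liminf (fun k => ENNReal.ofReal (f k x)) Filter.atTop ∂μ := by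
          refine lintegral_congr_ae ?_
          filter_upwards [hlim] with x hx
          exact ((ENNReal.continuous_ofReal.tendsto _).comp hx).liminf_eq.symm
      _ ≤ Filter.liminf (fun k => ∫⁻ x, ENNReal.ofReal (f k x) ∂μ) Filter.atTop :=
          lintegral_liminf_le' fun k => (hf k).aemeasurable.ennreal_ofReal
      _ ≤ ENNReal.ofReal C := by
          refine Filter.liminf_le_of_le (by isBoundedDefault) fun b hb => ?_
          obtain ⟨k, hk⟩ := hb.exists
          refine hk.trans ?_
          rw [← ofReal_integral_eq_lintegral_ofReal (hf k)
            (Filter.Eventually.of_forall (hf0 k))]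
          exact ENNReal.ofReal_le_ofReal (hC k)
  have hgi : Integrable g μ :=
    ⟨hgm, (hasFiniteIntegral_iff_ofReal hg0).2 (hle.trans_lt ENNReal.ofReal_lt_top)⟩
  refine ⟨hgi, ?_⟩
  have hμC : 0 ≤ C := (integral_nonneg (hf0 0)).trans (hC 0)
  rw [← ofReal_integral_eq_lintegral_ofReal hgi hg0] at hle
  exact (ENNReal.ofReal_le_ofReal_iff hμC).1 hle

section

variable {X : Type*} [MeasurableSpace X] {μ : Measure X} [IsProbabilityMeasure μ] {q : X → ℝ}
  {C δ : ℝ}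

theorem le_integral_log_max (hC : 0 ≤ C)
    (hint : ∀ η > 0, Integrable (fun x => Real.log (max (q x) η)) μ)
    (hbound : ∀ η > 0, ∀ a,
      ∫ x, max (|Real.log (max (q x) η) - ∫ y, Real.log (max (q y) η) ∂μ| - a) 0 ∂μ ≤
        C * Real.exp (-a)) (hδ : 0 < δ) (hδq : μ {x | δ ≤ q x} ≠ 0) {η : ℝ} (hη : 0 < η) :
    Real.log δ - C / μ.real {x | δ ≤ q x} ≤ ∫ y, Real.log (max (q y) η) ∂μ := by
  set m := ∫ y, Real.log (max (q y) η) ∂μ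
  have hs : 0 < μ.real {x | δ ≤ q x} := ENNReal.toReal_pos hδq (measure_ne_top _ _)
  rw [sub_le_iff_le_add, ← sub_le_iff_le_add', le_div_iff₀ hs]
  by_cases hneg : Real.log δ - m ≤ 0
  · exact (mul_nonpos_of_nonpos_of_nonneg hneg hs.le).trans hC
  have h := hbound η hη 0
  have habs : ∀ t : ℝ, max |t| 0 = |t| := fun t => max_eq_left (abs_nonneg t)
  simp only [sub_zero, neg_zero, Real.exp_zero, mul_one, habs] at h
  refine le_trans ?_ (le_trans (mul_meas_ge_le_integral_of_nonneg
    (Filter.Eventually.of_forall fun x => abs_nonneg _)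
    ((hint η hη).sub (integrable_const m)).abs (Real.log δ - m)) h)
  refine mul_le_mul_of_nonneg_left ?_ (not_le.1 hneg).le
  refine measureReal_mono fun x hx => ?_
  have hx' : δ ≤ q x := hx
  exact le_trans (sub_le_sub_right (Real.log_le_log hδ (hx'.trans (le_max_left _ _))) _)
    (le_abs_self _)

theorem measure_zero_set_eq_zero (hC : 0 ≤ C)
    (hint : ∀ η > 0, Integrable (fun x => Real.log (max (q x) η)) μ)
    (hbound : ∀ η > 0, ∀ a,
      ∫ x, max (|Real.log (max (q x) η) - ∫ y, Real.log (max (q y) η) ∂μ| - a) 0 ∂μ ≤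
        C * Real.exp (-a)) (hδ : 0 < δ) (hδq : μ {x | δ ≤ q x} ≠ 0) : μ {x | q x = 0} = 0 := by
  by_contra hz
  have hz' : 0 < μ.real {x | q x = 0} := ENNReal.toReal_pos hz (measure_ne_top _ _)
  set B := Real.log δ - C / μ.real {x | δ ≤ q x}
  set η := Real.exp (B - C / μ.real {x | q x = 0} - 1) with hη
  have hη0 : 0 < η := Real.exp_pos _
  have hB := le_integral_log_max hC hint hbound hδ hδq hη0
  set m := ∫ y, Real.log (max (q y) η) ∂μ
  have hlog : Real.log η = B - C / μ.real {x | q x = 0} - 1 := Real.log_exp _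
  have hCz : 0 ≤ C / μ.real {x | q x = 0} := div_nonneg hC hz'.le
  have h := hbound η hη0 0
  have habs : ∀ t : ℝ, max |t| 0 = |t| := fun t => max_eq_left (abs_nonneg t)
  simp only [sub_zero, neg_zero, Real.exp_zero, mul_one, habs] at h
  have h2 : (m - Real.log η) * μ.real {x | q x = 0} ≤ C := by
    refine le_trans ?_ (le_trans (mul_meas_ge_le_integral_of_nonneg
      (Filter.Eventually.of_forall fun x => abs_nonneg _)
      ((hint η hη0).sub (integrable_const m)).abs (m - Real.log η)) h)
    refine mul_le_mul_of_nonneg_left ?_ (by linarith)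
    refine measureReal_mono fun x hx => ?_
    have hx' : q x = 0 := hx
    change m - Real.log η ≤ |Real.log (max (q x) η) - m|
    rw [hx', max_eq_right hη0.le, abs_sub_comm]
    exact le_abs_self _
  rw [← le_div_iff₀ hz'] at h2
  linarith

theorem integrable_log_and_integral_le_of_max (hq0 : ∀ x, 0 ≤ q x) (hC : 0 ≤ C)
    (hint : ∀ η > 0, Integrable (fun x => Real.log (max (q x) η)) μ)
    (hbound : ∀ η > 0, ∀ a,
      ∫ x, max (|Real.log (max (q x) η) - ∫ y, Real.log (max (q y) η) ∂μ| - a) 0 ∂μ ≤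
        C * Real.exp (-a)) (hδ : 0 < δ) (hδq : μ {x | δ ≤ q x} ≠ 0) :
    Integrable (fun x => Real.log (q x)) μ ∧
      ∀ a, ∫ x, max (|Real.log (q x) - ∫ y, Real.log (q y) ∂μ| - a) 0 ∂μ ≤ C * Real.exp (-a) := by
  have hz := measure_eq_zero_iff_ae_notMem.1 (measure_zero_set_eq_zero hC hint hbound hδ hδq)
  set η : ℕ → ℝ := fun k => ((k : ℝ) + 1)⁻¹ with hηdef
  have hη0 : ∀ k, 0 < η k := fun k => by positivity
  have hη1 : ∀ k, η k ≤ 1 := fun k => inv_le_one_of_one_le₀ (by simp)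
  have hηlim : Filter.Tendsto η Filter.atTop (nhds 0) := by
    simpa [hηdef, one_div] using tendsto_one_div_add_atTop_nhds_zero_nat (𝕜 := ℝ)
  set g : ℕ → X → ℝ := fun k x => Real.log (max (q x) (η k)) with hg
  have hgi : ∀ k, Integrable (g k) μ := fun k => hint _ (hη0 k)
  have h1i : Integrable (fun x => Real.log (max (q x) 1)) μ := hint 1 one_pos
  have hlim : ∀ᵐ x ∂μ, Filter.Tendsto (fun k => g k x) Filter.atTop (nhds (Real.log (q x))) := by
    filter_upwards [hz] with x hx
    have hx0 : 0 < q x := lt_of_le_of_ne (hq0 x) (Ne.symm hx)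
    refine tendsto_const_nhds.congr' ?_
    filter_upwards [hηlim.eventually_lt_const hx0] with k hk
    simp only [hg]
    rw [max_eq_left hk.le]
  have hg1 : ∀ k x, g k x ≤ Real.log (max (q x) 1) := fun k x =>
    Real.log_le_log ((hη0 k).trans_le (le_max_right _ _)) (max_le_max_left _ (hη1 k))
  have hfat := integrable_of_tendsto_of_integral_le
    (f := fun k x => Real.log (max (q x) 1) - g k x)
    (g := fun x => Real.log (max (q x) 1) - Real.log (q x))
    (C := ∫ x, Real.log (max (q x) 1) ∂μ - (Real.log δ - C / μ.real {x | δ ≤ q x}))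
    (fun k => h1i.sub (hgi k)) (fun k x => sub_nonneg.2 (hg1 k x)) (fun k => by
      rw [integral_sub h1i (hgi k)]
      exact sub_le_sub_left (le_integral_log_max hC hint hbound hδ hδq (hη0 k)) _)
    (by filter_upwards [hlim] with x hx using tendsto_const_nhds.sub hx)
  have hlogi : Integrable (fun x => Real.log (q x)) μ := by
    have := h1i.sub hfat.1
    refine this.congr (Filter.Eventually.of_forall fun x => ?_)
    simp
  refine ⟨hlogi, fun a => ?_⟩
  have hmlim : Filter.Tendsto (fun k => ∫ x, g k x ∂μ) Filter.atTop
      (nhds (∫ x, Real.log (q x) ∂μ)) := by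
    refine tendsto_integral_of_dominated_convergence
      (fun x => |Real.log (max (q x) 1)| + |Real.log (q x)|)
      (fun k => (hgi k).aestronglyMeasurable) (h1i.abs.add hlogi.abs) (fun k => ?_) hlim
    filter_upwards [hz] with x hx
    have hx0 : 0 < q x := lt_of_le_of_ne (hq0 x) (Ne.symm hx)
    have h2 : Real.log (q x) ≤ g k x := Real.log_le_log hx0 (le_max_left _ _)
    rw [Real.norm_eq_abs, abs_le]
    constructor
    · linarith [neg_abs_le (Real.log (q x)), abs_nonneg (Real.log (max (q x) 1))]
    · linarith [hg1 k x, le_abs_self (Real.log (max (q x) 1)), abs_nonneg (Real.log (q x))]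
  refine (integrable_of_tendsto_of_integral_le
    (f := fun k x => max (|g k x - ∫ y, g k y ∂μ| - a) 0) (fun k => ?_)
    (fun k x => le_max_right _ _) (fun k => hbound _ (hη0 k) a) ?_).2
  · exact ((((hgi k).sub (integrable_const _)).abs).sub (integrable_const a)).pos_part
  · filter_upwards [hlim] with x hx
    exact (((hx.sub hmlim).abs).sub_const a).max tendsto_const_nhds

end

theorem natDegree_aeval_le_totalDegree {n : ℕ} (P : MvPolynomial (Fin n) ℂ)
    (g : Fin n → Polynomial ℂ) (hg : ∀ i, (g i).natDegree ≤ 1) :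
    (MvPolynomial.aeval g P).natDegree ≤ P.totalDegree := by
  rw [MvPolynomial.aeval_def, MvPolynomial.eval₂_eq']
  refine Polynomial.natDegree_sum_le_of_forall_le _ _ fun s hs => ?_
  refine (Polynomial.natDegree_C_mul_le _ _).trans ?_
  refine (Polynomial.natDegree_prod_le _ _).trans ?_
  refine le_trans (Finset.sum_le_sum (g := fun i => s i) fun i _ => ?_)
    (le_trans (le_of_eq ?_) (MvPolynomial.le_totalDegree hs))
  · exact Polynomial.natDegree_pow_le.trans (by nlinarith [hg i, Nat.zero_le (s i)])
  · rw [Finsupp.sum_fintype]; simp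

theorem volume_sublevel_max_le {n d : ℕ} (hd : 1 ≤ d) (P : MvPolynomial (Fin n) ℂ)
    (hP : P.totalDegree ≤ d) {η : ℝ} (hη : 0 < η) (p e : Fin n → ℝ) (a b v ε : ℝ)
    (hv : v ∈ Set.Icc a b) (hε : 0 ≤ ε) :
    volume {s ∈ Set.Icc a b |
      max (‖MvPolynomial.eval (fun i => (((p + s • e) i : ℝ) : ℂ)) P‖ ^ (d : ℝ)⁻¹) η ≤
        ε * max (‖MvPolynomial.eval (fun i => (((p + v • e) i : ℝ) : ℂ)) P‖ ^ (d : ℝ)⁻¹) η} ≤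
      ENNReal.ofReal (2 * Real.exp 1 * ε * (b - a)) := by
  have hd0 : d ≠ 0 := by omega
  have hab : 0 ≤ b - a := by linarith [hv.1, hv.2]
  rcases le_or_gt 1 ε with h1 | h1
  · refine (measure_mono (Set.sep_subset _ _)).trans ?_
    rw [Real.volume_Icc]
    refine ENNReal.ofReal_le_ofReal ?_
    have : 1 ≤ 2 * Real.exp 1 * ε := by nlinarith [Real.add_one_le_exp 1]
    nlinarith
  set R : Polynomial ℂ := MvPolynomial.aeval
    (fun i => Polynomial.C ((p i : ℝ) : ℂ) + Polynomial.C ((e i : ℝ) : ℂ) * Polynomial.X) P with hR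
  have hReval : ∀ s : ℝ, R.eval (s : ℂ) =
      MvPolynomial.eval (fun i => (((p + s • e) i : ℝ) : ℂ)) P := fun s => by
    rw [hR, MvPolynomial.aeval_def, Polynomial.algebraMap_eq, MvPolynomial.polynomial_eval_eval₂]
    have h1 : (Polynomial.evalRingHom (s : ℂ)).comp Polynomial.C = RingHom.id ℂ := by
      ext; simp
    rw [h1, MvPolynomial.eval]
    congr 1
    refine funext fun i => ?_
    simp only [Polynomial.eval_add, Polynomial.eval_mul, Polynomial.eval_C, Polynomial.eval_X,
      Pi.add_apply, Pi.smul_apply, smul_eq_mul, Complex.ofReal_add, Complex.ofReal_mul]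
    ring
  have hRd : R.natDegree ≤ d := (natDegree_aeval_le_totalDegree P _ fun i => by
    compute_degree).trans hP
  simp only [← hReval]
  by_cases hvη : ‖R.eval (v : ℂ)‖ ^ (d : ℝ)⁻¹ ≤ η
  · rw [max_eq_right hvη]
    have : {s ∈ Set.Icc a b | max (‖R.eval (s : ℂ)‖ ^ (d : ℝ)⁻¹) η ≤ ε * η} = ∅ := by
      refine Set.eq_empty_of_forall_notMem fun s hs => ?_
      have := (le_max_right _ _).trans hs.2
      nlinarith
    rw [this, measure_empty]
    exact zero_le
  · have hvη' := not_le.1 hvη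
    rw [max_eq_left hvη'.le]
    have hne : R.eval (v : ℂ) ≠ 0 := fun h => by
      rw [h, norm_zero, Real.zero_rpow (by positivity)] at hvη'
      linarith
    refine le_trans (measure_mono (t := {s ∈ Set.Icc a b |
      ‖R.eval (s : ℂ)‖ ≤ ε ^ d * ‖R.eval (v : ℂ)‖}) fun s hs => ⟨hs.1, ?_⟩)
      (volume_sublevel_polynomial_le hd R hRd hv hε hne)
    have h2 := (le_max_left _ _).trans hs.2
    have h3 := pow_le_pow_left₀ (by positivity) h2 d
    rwa [mul_pow, Real.rpow_inv_natCast_pow (norm_nonneg _) hd0,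
      Real.rpow_inv_natCast_pow (norm_nonneg _) hd0] at h3

theorem exists_measure_superlevel_ne_zero {n : ℕ} {F : Set (Fin n → ℝ)} (hF : IsCompact F)
    (hFc : Convex ℝ F) (hF0 : volume F ≠ 0) {q : (Fin n → ℝ) → ℝ} (hq : Continuous q)
    {x₀ : Fin n → ℝ} (hx₀ : x₀ ∈ F) (hqx : 0 < q x₀) :
    ∃ δ > 0, ProbabilityTheory.cond volume F {x | δ ≤ q x} ≠ 0 := by
  refine ⟨q x₀ / 2, by linarith, ?_⟩
  have hint : (interior F).Nonempty := by
    by_contra h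
    rw [Set.not_nonempty_iff_eq_empty] at h
    refine hF0 (measure_mono_null (t := frontier F) ?_ (hFc.addHaar_frontier volume))
    rw [frontier, h, Set.sdiff_empty]
    exact subset_closure
  have hx : x₀ ∈ closure (interior F) := by
    rw [hFc.closure_interior_eq_closure_of_nonempty_interior hint]
    exact subset_closure hx₀
  have hU : IsOpen {x | q x₀ / 2 < q x} := isOpen_lt continuous_const hq
  have hne := mem_closure_iff.1 hx _ hU (show q x₀ / 2 < q x₀ by linarith)
  have hpos := (hU.inter isOpen_interior).measure_pos volume hne
  rw [ProbabilityTheory.cond_apply hF.measurableSet]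
  refine mul_ne_zero (ENNReal.inv_ne_zero.2 hF.measure_lt_top.ne) (ne_of_gt (hpos.trans_le ?_))
  exact measure_mono fun x hx => ⟨interior_subset hx.2,
    (show q x₀ / 2 ≤ q x from le_of_lt (show q x₀ / 2 < q x from hx.1))⟩

theorem continuous_eval_ofReal {n : ℕ} (P : MvPolynomial (Fin n) ℂ) :
    Continuous fun x : Fin n → ℝ => MvPolynomial.eval (fun i => ((x i : ℝ) : ℂ)) P :=
  (MvPolynomial.continuous_eval P).comp (by fun_prop)

/-- Concentration of `log |P|` on a convex body, for a polynomial `P` of degree at most `d`. -/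
theorem integrable_log_norm_eval_and_integral_le {n d : ℕ} (hd : 1 ≤ d) {F : Set (Fin n → ℝ)}
    (hF : IsCompact F) (hFc : Convex ℝ F) (hF0 : volume F ≠ 0) (P : MvPolynomial (Fin n) ℂ)
    (hP : P.totalDegree ≤ d) {x₀ : Fin n → ℝ} (hx₀ : x₀ ∈ F)
    (hPx : MvPolynomial.eval (fun i => ((x₀ i : ℝ) : ℂ)) P ≠ 0) :
    Integrable (fun x : Fin n → ℝ => Real.log ‖MvPolynomial.eval (fun i => ((x i : ℝ) : ℂ)) P‖ / d)
      (ProbabilityTheory.cond volume F) ∧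
    ∀ a, ∫ x, max (|Real.log ‖MvPolynomial.eval (fun i => ((x i : ℝ) : ℂ)) P‖ / d -
      ∫ y, Real.log ‖MvPolynomial.eval (fun i => ((y i : ℝ) : ℂ)) P‖ / d
        ∂(ProbabilityTheory.cond volume F)| - a) 0 ∂(ProbabilityTheory.cond volume F) ≤
      8 * Real.exp 1 * Real.exp (-a) := by
  have hd0 : (0 : ℝ) < d := by exact_mod_cast hd
  set q : (Fin n → ℝ) → ℝ := fun x =>
    ‖MvPolynomial.eval (fun i => ((x i : ℝ) : ℂ)) P‖ ^ (d : ℝ)⁻¹ with hq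
  have hqc : Continuous q := (continuous_eval_ofReal P).norm.rpow_const
    fun _ => Or.inr (by positivity)
  have hlog : ∀ x : Fin n → ℝ,
      Real.log ‖MvPolynomial.eval (fun i => ((x i : ℝ) : ℂ)) P‖ / d = Real.log (q x) := fun x => by
    rcases eq_or_ne (MvPolynomial.eval (fun i => ((x i : ℝ) : ℂ)) P) 0 with h | h
    · simp [hq, h, hd0.ne']
    · rw [hq, Real.log_rpow (norm_pos_iff.2 h), div_eq_inv_mul]
  simp only [hlog]
  have := ProbabilityTheory.cond_isProbabilityMeasure_of_finite hF0 hF.measure_lt_top.ne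
  obtain ⟨δ, hδ, hδq⟩ := exists_measure_superlevel_ne_zero hF hFc hF0 hqc hx₀
    (Real.rpow_pos_of_pos (norm_pos_iff.2 hPx) _)
  have hmax : ∀ η > 0, Continuous fun x => Real.log (max (q x) η) := fun η hη =>
    (hqc.max continuous_const).log fun x => (hη.trans_le (le_max_right _ _)).ne'
  refine integrable_log_and_integral_le_of_max (fun x => by positivity)
    (by positivity) (fun η hη => ?_) (fun η hη a => ?_) hδ hδq
  · exact ((hmax η hη).continuousOn.integrableOn_compact hF).smul_measure (ENNReal.inv_ne_top.2 hF0)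
  · have := integral_abs_log_sub_le_of_convex hF hFc hF0 (c := 2 * Real.exp 1)
      (by linarith [Real.add_one_le_exp 1]) (hqc.max (continuous_const (y := η)))
      (fun x => hη.trans_le (le_max_right _ _))
      (fun p e a b v ε hv hε => volume_sublevel_max_le hd P hP hη p e a b v ε hv hε) a
    refine this.trans (le_of_eq (by ring))

section

variable {u φ : ℂ → ℝ} {e z : ℂ}

theorem ContDiffAt.fderiv_apply_const (hu : ContDiffAt ℝ 2 u z) (e : ℂ) :
    ContDiffAt ℝ 1 (fun w => fderiv ℝ u w e) z :=
  (hu.fderiv_right (m := 1) (by norm_num)).clm_apply contDiffAt_const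

theorem ContDiffAt.continuousAt_fderiv_fderiv (hu : ContDiffAt ℝ 2 u z) (e : ℂ) :
    ContinuousAt (fun w => fderiv ℝ (fun v => fderiv ℝ u v e) w e) z :=
  (((hu.fderiv_apply_const e).fderiv_right (m := 0) (by norm_num)).clm_apply
    contDiffAt_const).continuousAt

theorem integrable_mul_of_continuousAt_tsupport {g h : ℂ → ℝ} {K : Set ℂ} (hK : IsCompact K)
    (hg : ∀ z ∈ K, ContinuousAt g z) (hh : ∀ z ∈ K, ContinuousAt h z)
    (hs : tsupport h ⊆ K) : Integrable fun z => g z * h z := by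
  refine (integrableOn_iff_integrable_of_support_subset (s := K) ?_).1
    (ContinuousOn.integrableOn_compact hK fun z hz =>
      ((hg z hz).mul (hh z hz)).continuousWithinAt)
  exact (Function.support_mul_subset_right g h).trans ((subset_tsupport h).trans hs)

theorem integral_mul_fderiv_fderiv (hφ : ContDiff ℝ 2 φ) (hc : HasCompactSupport φ)
    (hu : ∀ z ∈ tsupport φ, ContDiffAt ℝ 2 u z) (e : ℂ) :
    ∫ z, u z * fderiv ℝ (fun v => fderiv ℝ φ v e) z e =
      ∫ z, fderiv ℝ (fun v => fderiv ℝ u v e) z e * φ z := by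
  have hK : IsCompact (tsupport φ) := hc
  have hφ1 : ContDiff ℝ 1 fun w => fderiv ℝ φ w e :=
    contDiff_iff_contDiffAt.2 fun z => hφ.contDiffAt.fderiv_apply_const e
  have hs1 := tsupport_fderiv_apply_subset ℝ (f := φ) e
  have hs2 := (tsupport_fderiv_apply_subset ℝ (f := fun w => fderiv ℝ φ w e) e).trans hs1
  have hu1 : ∀ z ∈ tsupport φ, ContDiffAt ℝ 1 (fun w => fderiv ℝ u w e) z := fun z hz =>
    (hu z hz).fderiv_apply_const e
  rw [integral_mul_fderiv_eq_neg_fderiv_mul_of_integrable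
    (integrable_mul_of_continuousAt_tsupport hK (fun z hz => (hu1 z hz).continuousAt)
      (fun z _ => hφ1.continuous.continuousAt) hs1)
    (integrable_mul_of_continuousAt_tsupport hK (fun z hz => (hu z hz).continuousAt)
      (fun z _ => hφ.contDiffAt.continuousAt_fderiv_fderiv e) hs2)
    (integrable_mul_of_continuousAt_tsupport hK (fun z hz => (hu z hz).continuousAt)
      (fun z _ => hφ1.continuous.continuousAt) hs1)
    (fun z hz => (hu z (hs1 hz)).differentiableAt (by norm_num))
    (fun z _ => hφ1.contDiffAt.differentiableAt (by norm_num))]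
  rw [integral_mul_fderiv_eq_neg_fderiv_mul_of_integrable
    (integrable_mul_of_continuousAt_tsupport hK
      (fun z hz => (hu z hz).continuousAt_fderiv_fderiv e)
      (fun z _ => hφ.continuous.continuousAt) subset_rfl)
    (integrable_mul_of_continuousAt_tsupport hK (fun z hz => (hu1 z hz).continuousAt)
      (fun z _ => hφ1.continuous.continuousAt) hs1)
    (integrable_mul_of_continuousAt_tsupport hK (fun z hz => (hu1 z hz).continuousAt)
      (fun z _ => hφ.continuous.continuousAt) subset_rfl)
    (fun z hz => (hu1 z hz).differentiableAt (by norm_num))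
    (fun z _ => hφ.contDiffAt.differentiableAt (by norm_num)), neg_neg]

theorem tsupport_planarLaplacian_subset (φ : ℂ → ℝ) :
    tsupport (planarLaplacian φ) ⊆ tsupport φ := by
  have h : ∀ e, tsupport (fun z => fderiv ℝ (fun w => fderiv ℝ φ w e) z e) ⊆ tsupport φ :=
    fun e => (tsupport_fderiv_apply_subset ℝ e).trans (tsupport_fderiv_apply_subset ℝ e)
  exact (tsupport_add _ _).trans (Set.union_subset (h 1) (h Complex.I))

theorem continuous_planarLaplacian (hφ : ContDiff ℝ 2 φ) : Continuous (planarLaplacian φ) :=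
  continuous_iff_continuousAt.2 fun _ =>
    (hφ.contDiffAt.continuousAt_fderiv_fderiv 1).add
      (hφ.contDiffAt.continuousAt_fderiv_fderiv Complex.I)

theorem HasCompactSupport.planarLaplacian (hc : HasCompactSupport φ) :
    HasCompactSupport (planarLaplacian φ) :=
  hc.of_isClosed_subset (isClosed_tsupport _) (tsupport_planarLaplacian_subset φ)

/-- Green's identity against a test function. -/
theorem integral_mul_planarLaplacian (hφ : ContDiff ℝ 2 φ) (hc : HasCompactSupport φ)
    (hu : ∀ z ∈ tsupport φ, ContDiffAt ℝ 2 u z) :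
    ∫ z, u z * planarLaplacian φ z = ∫ z, planarLaplacian u z * φ z := by
  have hK : IsCompact (tsupport φ) := hc
  have hi : ∀ e, Integrable fun z => u z * fderiv ℝ (fun v => fderiv ℝ φ v e) z e := fun e =>
    integrable_mul_of_continuousAt_tsupport hK (fun z hz => (hu z hz).continuousAt)
      (fun z _ => hφ.contDiffAt.continuousAt_fderiv_fderiv e)
      ((tsupport_fderiv_apply_subset ℝ e).trans (tsupport_fderiv_apply_subset ℝ e))
  have hj : ∀ e, Integrable fun z => fderiv ℝ (fun v => fderiv ℝ u v e) z e * φ z := fun e =>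
    integrable_mul_of_continuousAt_tsupport hK
      (fun z hz => (hu z hz).continuousAt_fderiv_fderiv e)
      (fun z _ => hφ.continuous.continuousAt) subset_rfl
  simp only [planarLaplacian, mul_add, add_mul]
  rw [integral_add (hi _) (hi _), integral_add (hj _) (hj _), integral_mul_fderiv_fderiv hφ hc hu,
    integral_mul_fderiv_fderiv hφ hc hu]

theorem planarLaplacian_eq_laplacian (hu : ContDiffAt ℝ 2 u z) :
    planarLaplacian u z = Laplacian.laplacian u z := by
  have h : ∀ e : ℂ, fderiv ℝ (fun v => fderiv ℝ u v e) z e = iteratedFDeriv ℝ 2 u z ![e, e] := by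
    intro e
    rw [iteratedFDeriv_two_apply,
      fderiv_clm_apply ((hu.fderiv_right (m := 1) (by norm_num)).differentiableAt (by norm_num))
        (differentiableAt_const e)]
    simp
  rw [planarLaplacian, h, h, InnerProductSpace.laplacian_eq_iteratedFDeriv_complexPlane]

/-- `log |g|` is harmonic off the zeros of `g`. -/
theorem integral_log_norm_mul_planarLaplacian_eq_zero {g : ℂ → ℂ} (hφ : ContDiff ℝ 2 φ)
    (hc : HasCompactSupport φ) (hg : ∀ z ∈ tsupport φ, AnalyticAt ℂ g z)
    (hg0 : ∀ z ∈ tsupport φ, g z ≠ 0) :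
    ∫ z, Real.log ‖g z‖ * planarLaplacian φ z = 0 := by
  have hh := fun z (hz : z ∈ tsupport φ) => (hg z hz).harmonicAt_log_norm (hg0 z hz)
  rw [integral_mul_planarLaplacian hφ hc fun z hz => (hh z hz).1]
  refine integral_eq_zero_of_ae (Filter.Eventually.of_forall fun z => ?_)
  by_cases hz : z ∈ tsupport φ
  · have : planarLaplacian (fun z => Real.log ‖g z‖) z = 0 := by
      rw [planarLaplacian_eq_laplacian (hh z hz).1]
      exact (hh z hz).2.self_of_nhds
    simp [this]
  · simp [image_eq_zero_of_notMem_tsupport hz]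

end

section

variable {φ : ℂ → ℝ} {w z : ℂ} {ε : ℝ}

theorem integrableOn_log_norm_sub (w : ℂ) {K : Set ℂ} (hK : IsCompact K) :
    IntegrableOn (fun z => Real.log ‖z - w‖) K := by
  have h0 : ∀ r : ℝ, IntegrableOn (fun z : ℂ => Real.log ‖z‖) (Metric.ball 0 r) := by
    intro r
    rw [integrableOn_fun_norm_addHaar volume (f := Real.log), Complex.finrank_real_complex]
    have : ContinuousOn (fun y : ℝ => y ^ (2 - 1) • Real.log y) (Set.Icc 0 r) := by
      simpa using Real.continuous_mul_log.continuousOn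
    exact (this.integrableOn_compact isCompact_Icc).mono_set Set.Ioo_subset_Icc_self
  obtain ⟨r, hr⟩ := hK.isBounded.subset_ball w
  refine IntegrableOn.mono_set ?_ hr
  have := (measurePreserving_sub_right volume w).integrableOn_comp_preimage
    (MeasurableEquiv.subRight w).measurableEmbedding (f := fun z : ℂ => Real.log ‖z‖)
    (s := Metric.ball 0 r)
  have hb : Metric.ball w r = (fun x => x - w) ⁻¹' Metric.ball 0 r := by
    ext z
    simp [dist_eq_norm]
  rw [hb]
  exact this.2 (h0 r)

theorem hasFDerivAt_log_normSq_add (w : ℂ) (hε : 0 < ε) (z : ℂ) :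
    HasFDerivAt (fun z : ℂ => Real.log ((z.re - w.re) ^ 2 + (z.im - w.im) ^ 2 + ε) / 2)
      (((z.re - w.re) ^ 2 + (z.im - w.im) ^ 2 + ε)⁻¹ •
        ((z.re - w.re) • Complex.reCLM + (z.im - w.im) • Complex.imCLM)) z := by
  have hre : HasFDerivAt (fun z : ℂ => z.re - w.re) Complex.reCLM z :=
    Complex.reCLM.hasFDerivAt.sub_const _
  have him : HasFDerivAt (fun z : ℂ => z.im - w.im) Complex.imCLM z :=
    Complex.imCLM.hasFDerivAt.sub_const _
  have hs0 : (z.re - w.re) ^ 2 + (z.im - w.im) ^ 2 + ε ≠ 0 := by positivity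
  have h := ((((hre.pow 2).add (him.pow 2)).add_const ε).log hs0).mul_const (2⁻¹ : ℝ)
  simp only [← div_eq_mul_inv] at h
  refine h.congr_fderiv ?_
  ext; simp; ring

theorem planarLaplacian_log_normSq_add (w : ℂ) (hε : 0 < ε) (z : ℂ) :
    planarLaplacian (fun z : ℂ => Real.log ((z.re - w.re) ^ 2 + (z.im - w.im) ^ 2 + ε) / 2) z =
      2 * ε / ((z.re - w.re) ^ 2 + (z.im - w.im) ^ 2 + ε) ^ 2 := by
  have hre : HasFDerivAt (fun z : ℂ => z.re - w.re) Complex.reCLM z :=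
    Complex.reCLM.hasFDerivAt.sub_const _
  have him : HasFDerivAt (fun z : ℂ => z.im - w.im) Complex.imCLM z :=
    Complex.imCLM.hasFDerivAt.sub_const _
  have hs := ((hre.pow 2).add (him.pow 2)).add_const ε
  have hs0 : (z.re - w.re) ^ 2 + (z.im - w.im) ^ 2 + ε ≠ 0 := by positivity
  have hi := (hasDerivAt_inv hs0).comp_hasFDerivAt z hs
  have hx := hi.mul hre
  have hy := hi.mul him
  simp only [planarLaplacian, (hasFDerivAt_log_normSq_add w hε _).fderiv]
  simp only [smul_apply, add_apply, Complex.reCLM_apply,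
    Complex.imCLM_apply, Complex.one_re, Complex.one_im, Complex.I_re, Complex.I_im, smul_eq_mul,
    mul_one, mul_zero, add_zero, zero_add]
  have e1 : fderiv ℝ (fun z : ℂ => ((z.re - w.re) ^ 2 + (z.im - w.im) ^ 2 + ε)⁻¹ *
    (z.re - w.re)) z = _ := hx.fderiv
  have e2 : fderiv ℝ (fun z : ℂ => ((z.re - w.re) ^ 2 + (z.im - w.im) ^ 2 + ε)⁻¹ *
    (z.im - w.im)) z = _ := hy.fderiv
  rw [e1, e2]
  simp
  field_simp
  ring

theorem integrable_inv_one_add_normSq :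
    Integrable (fun z : ℂ => 2 / (‖z‖ ^ 2 + 1) ^ 2) ∧
      ∫ z : ℂ, 2 / (‖z‖ ^ 2 + 1) ^ 2 = 2 * Real.pi := by
  have hd : ∀ y ∈ Set.Ici (0 : ℝ), HasDerivAt (fun y : ℝ => -(y ^ 2 + 1)⁻¹)
      (y ^ (2 - 1) • (2 / (y ^ 2 + 1) ^ 2)) y := by
    intro y _
    have := (((hasDerivAt_id y).pow 2).add_const 1).inv (by positivity : y ^ 2 + 1 ≠ 0)
    refine this.neg.congr_deriv ?_
    simp
    ring
  have hl : Filter.Tendsto (fun y : ℝ => -(y ^ 2 + 1)⁻¹) Filter.atTop (nhds 0) := by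
    rw [← neg_zero]
    refine Filter.Tendsto.neg (Filter.Tendsto.inv_tendsto_atTop ?_)
    exact Filter.tendsto_atTop_add_const_right _ _ (Filter.tendsto_pow_atTop two_ne_zero)
  have hi : IntegrableOn (fun y : ℝ => y ^ (2 - 1) • (2 / (y ^ 2 + 1) ^ 2)) (Set.Ioi 0) :=
    integrableOn_Ioi_deriv_of_nonneg' hd (fun y hy => by
      have : 0 < y := hy
      positivity) hl
  constructor
  · rw [integrable_fun_norm_addHaar volume (f := fun r : ℝ => 2 / (r ^ 2 + 1) ^ 2),
      Complex.finrank_real_complex]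
    exact hi
  · rw [integral_fun_norm_addHaar volume (fun r : ℝ => 2 / (r ^ 2 + 1) ^ 2),
      Complex.finrank_real_complex, integral_Ioi_of_hasDerivAt_of_tendsto' hd hi hl]
    simp [Measure.real, Complex.volume_ball]

theorem tendsto_integral_poisson (hφ : Continuous φ) (hc : HasCompactSupport φ) (w : ℂ) :
    Filter.Tendsto (fun k : ℕ => ∫ z, 2 * ((1 : ℝ) / (k + 1)) ^ 2 /
      ((z.re - w.re) ^ 2 + (z.im - w.im) ^ 2 + ((1 : ℝ) / (k + 1)) ^ 2) ^ 2 * φ z)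
      Filter.atTop (nhds (2 * Real.pi * φ w)) := by
  obtain ⟨hi, he⟩ := integrable_inv_one_add_normSq
  have hδ := tendsto_one_div_add_atTop_nhds_zero_nat (𝕜 := ℝ)
  set δ : ℕ → ℝ := fun k => 1 / (k + 1) with hδdef
  have hδ0 : ∀ k, 0 < δ k := fun k => by simp only [hδdef]; positivity
  obtain ⟨C, hC⟩ := hφ.bounded_above_of_compact_support hc
  have key : ∀ k : ℕ, ∫ z, 2 * (δ k) ^ 2 /
      ((z.re - w.re) ^ 2 + (z.im - w.im) ^ 2 + (δ k) ^ 2) ^ 2 * φ z =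
      ∫ y : ℂ, 2 / (‖y‖ ^ 2 + 1) ^ 2 * φ (w + δ k • y) := by
    intro k
    rw [← integral_add_left_eq_self _ w]
    have := Measure.integral_comp_smul (volume : Measure ℂ) (fun z => 2 * (δ k) ^ 2 /
      (((w + z).re - w.re) ^ 2 + ((w + z).im - w.im) ^ 2 + (δ k) ^ 2) ^ 2 * φ (w + z)) (δ k)
    rw [Complex.finrank_real_complex, abs_of_pos (by have := hδ0 k; positivity),
      eq_inv_smul_iff₀ (by have := hδ0 k; positivity), ← integral_smul] at this
    rw [← this]
    refine integral_congr_ae (Filter.Eventually.of_forall fun y => ?_)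
    have h0 := (hδ0 k).ne'
    have hn : ‖y‖ ^ 2 = y.re ^ 2 + y.im ^ 2 := by
      rw [Complex.sq_norm, Complex.normSq_apply]; ring
    simp only [Complex.add_re, Complex.add_im, add_sub_cancel_left, Complex.real_smul,
      Complex.re_ofReal_mul, Complex.im_ofReal_mul, smul_eq_mul, hn]
    have h1 : (δ k * y.re) ^ 2 + (δ k * y.im) ^ 2 + (δ k) ^ 2 =
      (δ k) ^ 2 * (y.re ^ 2 + y.im ^ 2 + 1) := by ring
    have h2 : y.re ^ 2 + y.im ^ 2 + 1 ≠ 0 := by positivity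
    rw [h1]
    field_simp
  change Filter.Tendsto (fun k => ∫ z, 2 * (δ k) ^ 2 /
    ((z.re - w.re) ^ 2 + (z.im - w.im) ^ 2 + (δ k) ^ 2) ^ 2 * φ z) _ _
  simp only [key]
  rw [← he, ← integral_mul_const]
  refine tendsto_integral_of_dominated_convergence (fun y : ℂ => 2 / (‖y‖ ^ 2 + 1) ^ 2 * C)
    (fun k => ?_) (hi.mul_const C) (fun k => ?_) ?_
  · exact hi.aestronglyMeasurable.mul (hφ.comp (by fun_prop)).aestronglyMeasurable
  · refine Filter.Eventually.of_forall fun y => ?_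
    rw [norm_mul, Real.norm_of_nonneg (by positivity)]
    exact mul_le_mul_of_nonneg_left (hC _) (by positivity)
  · refine Filter.Eventually.of_forall fun y => ?_
    refine tendsto_const_nhds.mul ((hφ.tendsto w).comp ?_)
    have : Filter.Tendsto (fun k => w + δ k • y) Filter.atTop (nhds (w + (0 : ℝ) • y)) :=
      tendsto_const_nhds.add (hδ.smul_const y)
    simpa using this

/-- `(2π)⁻¹ log |z - w|` is a fundamental solution of the Laplacian. -/
theorem integral_log_norm_sub_mul_planarLaplacian (hφ : ContDiff ℝ 2 φ)
    (hc : HasCompactSupport φ) (w : ℂ) :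
    ∫ z, Real.log ‖z - w‖ * planarLaplacian φ z = 2 * Real.pi * φ w := by
  set δ : ℕ → ℝ := fun k => 1 / (k + 1) with hδdef
  have hδ := tendsto_one_div_add_atTop_nhds_zero_nat (𝕜 := ℝ)
  have hδ0 : ∀ k, 0 < δ k := fun k => by simp only [hδdef]; positivity
  have hδ1 : ∀ k, δ k ≤ 1 := fun k => by
    simp only [hδdef]
    exact div_le_one_of_le₀ (by linarith [Nat.cast_nonneg (α := ℝ) k]) (by positivity)
  have hsq : ∀ z : ℂ, (z.re - w.re) ^ 2 + (z.im - w.im) ^ 2 = ‖z - w‖ ^ 2 := fun z => by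
    rw [Complex.sq_norm, Complex.normSq_apply, Complex.sub_re, Complex.sub_im]; ring
  set U : ℕ → ℂ → ℝ := fun k z =>
    Real.log ((z.re - w.re) ^ 2 + (z.im - w.im) ^ 2 + δ k ^ 2) / 2 with hU
  have hUc : ∀ k, ContDiff ℝ 2 (U k) := fun k => by
    refine ContDiff.div_const (ContDiff.log ?_ fun z => ?_) _
    · exact ((((Complex.reCLM.contDiff).sub contDiff_const).pow 2).add
        (((Complex.imCLM.contDiff).sub contDiff_const).pow 2)).add contDiff_const
    · have := hδ0 k
      positivity
  have hgreen : ∀ k, ∫ z, U k z * planarLaplacian φ z =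
      ∫ z, 2 * (δ k) ^ 2 / ((z.re - w.re) ^ 2 + (z.im - w.im) ^ 2 + (δ k) ^ 2) ^ 2 * φ z := by
    intro k
    rw [integral_mul_planarLaplacian hφ hc fun z _ => (hUc k).contDiffAt]
    have h0 := hδ0 k
    simp only [hU, planarLaplacian_log_normSq_add w (by positivity : 0 < δ k ^ 2)]
  have hlim := tendsto_integral_poisson hφ.continuous hc w
  refine tendsto_nhds_unique ?_ hlim
  change Filter.Tendsto (fun k => ∫ z, 2 * (δ k) ^ 2 /
    ((z.re - w.re) ^ 2 + (z.im - w.im) ^ 2 + (δ k) ^ 2) ^ 2 * φ z) _ _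
  simp only [← hgreen]
  have hLc := continuous_planarLaplacian hφ
  have hK : IsCompact (tsupport φ) := hc
  have hsub : ∀ g : ℂ → ℝ, IntegrableOn g (tsupport φ) →
      Integrable fun z => g z * planarLaplacian φ z := fun g hg => by
    refine (integrableOn_iff_integrable_of_support_subset (s := tsupport φ) ?_).1
      (hg.mul_continuousOn hLc.continuousOn hK)
    exact (Function.support_mul_subset_right _ _).trans
      ((subset_tsupport _).trans (tsupport_planarLaplacian_subset φ))
  have hne : ∀ᵐ z : ℂ, z ≠ w := by
    rw [ae_iff]; simp
  refine tendsto_integral_of_dominated_convergence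
    (fun z => (|Real.log ‖z - w‖| + Real.log (‖z - w‖ ^ 2 + 1)) * |planarLaplacian φ z|)
    (fun k => ((hUc k).continuous.mul hLc).aestronglyMeasurable) ?_ (fun k => ?_) ?_
  · have h1 := hsub (fun z => |Real.log ‖z - w‖| + Real.log (‖z - w‖ ^ 2 + 1))
      ((integrableOn_log_norm_sub w hK).abs.add
        ((Continuous.log (by fun_prop) fun z => by positivity).continuousOn.integrableOn_compact
          hK))
    refine h1.norm.congr (Filter.Eventually.of_forall fun z => ?_)
    have : 0 ≤ Real.log (‖z - w‖ ^ 2 + 1) := Real.log_nonneg (by nlinarith [norm_nonneg (z - w)])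
    simp only [norm_mul, Real.norm_eq_abs]
    rw [abs_of_nonneg (a := |Real.log ‖z - w‖| + Real.log (‖z - w‖ ^ 2 + 1)) (by positivity)]
  · filter_upwards [hne] with z hz
    have hr : 0 < ‖z - w‖ := norm_pos_iff.2 (sub_ne_zero.2 hz)
    rw [norm_mul, Real.norm_eq_abs, Real.norm_eq_abs]
    refine mul_le_mul_of_nonneg_right ?_ (abs_nonneg _)
    simp only [hU, hsq]
    have hδs : δ k ^ 2 ≤ 1 := pow_le_one₀ (hδ0 k).le (hδ1 k)
    have h1 : Real.log (‖z - w‖ ^ 2) ≤ Real.log (‖z - w‖ ^ 2 + δ k ^ 2) :=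
      Real.log_le_log (by positivity) (by nlinarith [hδ0 k])
    have h2 : Real.log (‖z - w‖ ^ 2 + δ k ^ 2) ≤ Real.log (‖z - w‖ ^ 2 + 1) :=
      Real.log_le_log (by positivity) (by linarith)
    have h3 : 0 ≤ Real.log (‖z - w‖ ^ 2 + 1) := Real.log_nonneg (by nlinarith [norm_nonneg (z - w)])
    rw [Real.log_pow] at h1
    push_cast at h1
    rw [abs_le]
    constructor
    · linarith [neg_abs_le (Real.log ‖z - w‖)]
    · linarith [abs_nonneg (Real.log ‖z - w‖)]
  · filter_upwards [hne] with z hz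
    have hr : 0 < ‖z - w‖ := norm_pos_iff.2 (sub_ne_zero.2 hz)
    refine Filter.Tendsto.mul_const _ ?_
    simp only [hU, hsq]
    have h1 : Filter.Tendsto (fun k => ‖z - w‖ ^ 2 + δ k ^ 2) Filter.atTop
        (nhds (‖z - w‖ ^ 2 + 0 ^ 2)) := tendsto_const_nhds.add (hδ.pow 2)
    have h2 := (h1.log (by positivity)).div_const 2
    convert h2 using 2
    rw [zero_pow two_ne_zero, add_zero, Real.log_pow]
    push_cast
    ring

end

/-- `g` vanishes to order exactly `m w` at every point `w` of `G`. -/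
def HasZeroOrderOn (g : ℂ → ℂ) (m : ℂ → ℕ) (G : Set ℂ) : Prop :=
  ∀ w ∈ G, ∃ h : ℂ → ℂ, AnalyticAt ℂ h w ∧ h w ≠ 0 ∧ ∀ᶠ z in nhds w, g z = (z - w) ^ m w * h z

section

variable {g : ℂ → ℂ} {m : ℂ → ℕ} {K : Set ℂ}

theorem HasZeroOrderOn.analyticOnNhd (h : HasZeroOrderOn g m K) : AnalyticOnNhd ℂ g K := by
  intro w hw
  obtain ⟨h, ha, -, he⟩ := h w hw
  refine AnalyticAt.congr ?_ (he.mono fun z hz => hz.symm)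
  fun_prop

theorem HasZeroOrderOn.meromorphicOrderAt_eq (h : HasZeroOrderOn g m K) {w : ℂ} (hw : w ∈ K) :
    meromorphicOrderAt g w = ((m w : ℤ) : WithTop ℤ) := by
  rw [meromorphicOrderAt_eq_int_iff (h.analyticOnNhd w hw).meromorphicAt]
  obtain ⟨h, ha, h0, he⟩ := h w hw
  refine ⟨h, ha, h0, (he.filter_mono nhdsWithin_le_nhds).mono fun z hz => ?_⟩
  rw [hz, zpow_natCast, smul_eq_mul]

/-- Jensen-type formula: `(2π)⁻¹ Δ log |g|` is the zero counting measure of `g`. -/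
theorem HasZeroOrderOn.exists_finset_integral_log_norm (h : HasZeroOrderOn g m K)
    (hK : IsCompact K) :
    IntegrableOn (fun z => Real.log ‖g z‖) K ∧
    ∃ S : Finset ℂ, (S : Set ℂ) ⊆ K ∧ (∀ w ∈ K, w ∉ S → m w = 0) ∧
      ∀ φ : ℂ → ℝ, ContDiff ℝ 2 φ → tsupport φ ⊆ K →
        ∫ z, Real.log ‖g z‖ * planarLaplacian φ z = 2 * Real.pi * ∑ w ∈ S, m w * φ w := by
  have hmer : MeromorphicOn g K := h.analyticOnNhd.meromorphicOn
  have hD : ∀ w ∈ K, MeromorphicOn.divisor g K w = m w := fun w hw => by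
    rw [MeromorphicOn.divisor_apply hmer hw, h.meromorphicOrderAt_eq hw, WithTop.untop₀_coe]
  have hfin : (MeromorphicOn.divisor g K).support.Finite :=
    (MeromorphicOn.divisor g K).finiteSupport hK
  obtain ⟨q, hqa, hq0, hgq⟩ := hmer.extract_zeros_poles
    (fun u => by rw [h.meromorphicOrderAt_eq u.2]; exact WithTop.coe_ne_top) hfin
  have hlog := MeromorphicOn.extract_zeros_poles_log hq0 hgq
  have hae := ae_restrict_le_codiscreteWithin (μ := volume) hK.measurableSet hlog
  set S := hfin.toFinset with hS
  have hSK : (S : Set ℂ) ⊆ K := by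
    rw [hS, Set.Finite.coe_toFinset]
    exact (MeromorphicOn.divisor g K).supportWithinDomain
  have hsum : ∀ᵐ z ∂(volume.restrict K), Real.log ‖g z‖ =
      ∑ w ∈ S, m w * Real.log ‖z - w‖ + Real.log ‖q z‖ := by
    refine Filter.Eventually.mono hae fun z hz => ?_
    refine hz.trans ?_
    rw [Pi.add_apply, finsum_eq_sum_of_support_subset (s := S), Finset.sum_apply]
    · congr 1
      refine Finset.sum_congr rfl fun w hw => ?_
      simp [hD w (hSK hw)]
    · intro w hw
      rw [hS, Set.Finite.coe_toFinset]
      intro h0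
      refine hw ?_
      ext z
      simp [h0]
  have hqi : IntegrableOn (fun z => Real.log ‖q z‖) K := by
    refine ContinuousOn.integrableOn_compact hK (ContinuousOn.log hqa.continuousOn.norm ?_)
    exact fun z hz => norm_ne_zero_iff.2 (hq0 ⟨z, hz⟩)
  have hli : ∀ w, IntegrableOn (fun z => m w * Real.log ‖z - w‖) K := fun w =>
    (integrableOn_log_norm_sub w hK).const_mul _
  refine ⟨((integrable_finsetSum S fun w _ => hli w).add hqi).congr
    (Filter.EventuallyEq.symm hsum), S, hSK, fun w hw hwS => ?_, fun φ hφ hφK => ?_⟩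
  · have : MeromorphicOn.divisor g K w = 0 := by
      by_contra h0
      exact hwS (by rw [hS, Set.Finite.mem_toFinset]; exact h0)
    rw [hD w hw] at this
    exact_mod_cast this
  · have hc : HasCompactSupport φ := hK.of_isClosed_subset (isClosed_tsupport φ) hφK
    have hsupp : Function.support (planarLaplacian φ) ⊆ K :=
      (subset_tsupport _).trans ((tsupport_planarLaplacian_subset φ).trans hφK)
    have hLc := continuous_planarLaplacian hφ
    have hred : ∀ u : ℂ → ℝ, ∫ z, u z * planarLaplacian φ z =
        ∫ z in K, u z * planarLaplacian φ z := fun u =>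
      (setIntegral_eq_integral_of_forall_compl_eq_zero fun z hz => by
        rw [Function.notMem_support.1 fun hz' => hz (hsupp hz'), mul_zero]).symm
    have hmul : ∀ u : ℂ → ℝ, IntegrableOn u K →
        IntegrableOn (fun z => u z * planarLaplacian φ z) K := fun u hu =>
      hu.mul_continuousOn hLc.continuousOn hK
    rw [hred, integral_congr_ae (g := fun z => ∑ w ∈ S, m w * Real.log ‖z - w‖ *
      planarLaplacian φ z + Real.log ‖q z‖ * planarLaplacian φ z) (hsum.mono fun z hz => by
        simp only [hz, add_mul, Finset.sum_mul]),
      integral_add (integrable_finsetSum S fun w _ => hmul _ (hli w)) (hmul _ hqi),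
      integral_finsetSum S fun w _ => hmul _ (hli w), ← hred,
      integral_log_norm_mul_planarLaplacian_eq_zero hφ hc (fun z hz => hqa z (hφK hz))
        (fun z hz => hq0 ⟨z, hφK hz⟩), add_zero, Finset.mul_sum]
    refine Finset.sum_congr rfl fun w _ => ?_
    simp only [mul_assoc]
    rw [integral_const_mul, ← hred, integral_log_norm_sub_mul_planarLaplacian hφ hc]
    ring

end

section

variable {Ω Z : Type*} [MeasurableSpace Ω] [MeasurableSpace Z] {P : Measure Ω}
  [IsProbabilityMeasure P] {μ : Measure Z} [IsFiniteMeasure μ] {L : Ω → Z → ℝ} {C : ℝ}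

theorem integrable_uncurry_of_integral_abs_sub_le (hLm : Measurable (Function.uncurry L))
    (hint : ∀ᵐ z ∂μ, Integrable (fun x => L x z) P)
    (htail : ∀ᵐ z ∂μ, ∫ x, |L x z - ∫ y, L y z ∂P| ∂P ≤ C)
    (hx : ∀ᵐ x ∂P, Integrable (L x) μ) :
    Integrable (Function.uncurry L) (P.prod μ) ∧
      Integrable (fun z => ∫ y, L y z ∂P) μ := by
  have hmm : Measurable fun z => ∫ y, L y z ∂P :=
    (hLm.stronglyMeasurable.integral_prod_left).measurable
  have hdm : Measurable fun p : Ω × Z => L p.1 p.2 - ∫ y, L y p.2 ∂P :=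
    hLm.sub (hmm.comp measurable_snd)
  have hd : Integrable (fun p : Ω × Z => L p.1 p.2 - ∫ y, L y p.2 ∂P) (P.prod μ) := by
    rw [integrable_prod_iff' hdm.aestronglyMeasurable]
    refine ⟨hint.mono fun z hz => hz.sub (integrable_const (∫ y, L y z ∂P)), ?_⟩
    refine Integrable.mono' (integrable_const C)
      hdm.stronglyMeasurable.norm.integral_prod_left.aestronglyMeasurable ?_
    refine htail.mono fun z hz => ?_
    rw [Real.norm_of_nonneg (integral_nonneg fun _ => norm_nonneg _)]
    exact hz
  obtain ⟨x, hx1, hx2⟩ := (hd.prod_right_ae.and hx).exists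
  have hm : Integrable (fun z => ∫ y, L y z ∂P) μ := by
    refine (hx2.sub hx1).congr (Filter.Eventually.of_forall fun z => ?_)
    simp
  refine ⟨?_, hm⟩
  refine (hd.add (hm.comp_snd P)).congr (Filter.Eventually.of_forall fun p => ?_)
  simp [Function.uncurry]

/-- Concentration passes from `L · z` to weighted averages over `z`. -/
theorem measureReal_weighted_integral_deviation_le (hLm : Measurable (Function.uncurry L))
    (hint : ∀ᵐ z ∂μ, Integrable (fun x => L x z) P)
    (htail : ∀ᵐ z ∂μ, ∀ a, ∫ x, max (|L x z - ∫ y, L y z ∂P| - a) 0 ∂P ≤ C * Real.exp (-a))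
    (hx : ∀ᵐ x ∂P, Integrable (L x) μ) {w : Z → ℝ} (hw : Measurable w) {B : ℝ}
    (hB : ∀ z, |w z| ≤ B) (hN : 0 < ∫ z, |w z| ∂μ) (t : ℝ) :
    Integrable (fun x => ∫ z, L x z * w z ∂μ) P ∧
    P.real {x | t * ∫ z, |w z| ∂μ ≤
      |(∫ z, L x z * w z ∂μ) - ∫ y, (∫ z, L y z * w z ∂μ) ∂P|} ≤
      C * Real.exp 1 * Real.exp (-t) := by
  have h0 : ∀ t : ℝ, max |t| 0 = |t| := fun t => max_eq_left (abs_nonneg t)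
  obtain ⟨hL, hm⟩ := integrable_uncurry_of_integral_abs_sub_le hLm hint
    (htail.mono fun z hz => by simpa [h0] using hz 0) hx
  have hwi : Integrable w μ := Integrable.mono' (integrable_const B) hw.aestronglyMeasurable
    (Filter.Eventually.of_forall hB)
  have hwP : AEStronglyMeasurable (fun p : Ω × Z => w p.2) (P.prod μ) :=
    (hw.comp measurable_snd).aestronglyMeasurable
  have hLw : Integrable (fun p : Ω × Z => L p.1 p.2 * w p.2) (P.prod μ) :=
    hL.mul_bdd (c := B) hwP (Filter.Eventually.of_forall fun p => hB _)
  set m : Z → ℝ := fun z => ∫ y, L y z ∂P with hmdef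
  set N := ∫ z, |w z| ∂μ
  have hmw : Integrable (fun z => m z * w z) μ :=
    hm.mul_bdd (c := B) hw.aestronglyMeasurable (Filter.Eventually.of_forall hB)
  refine ⟨hLw.integral_prod_left, ?_⟩
  have hE : ∫ y, (∫ z, L y z * w z ∂μ) ∂P = ∫ z, m z * w z ∂μ := by
    rw [integral_integral_swap hLw]
    simp only [integral_mul_const, hmdef]
  rw [hE]
  set T : Ω × Z → ℝ := fun p => max (|L p.1 p.2 - m p.2| - (t - 1)) 0 * |w p.2| with hT
  have hTi : Integrable T (P.prod μ) := by
    refine Integrable.mul_bdd (c := B) ?_ hwP.norm (Filter.Eventually.of_forall fun p => ?_)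
    · exact (((hL.sub (hm.comp_snd P)).abs).sub (integrable_const (t - 1))).pos_part
    · rw [Real.norm_eq_abs, abs_abs]; exact hB _
  have hTx : ∫ x, ∫ z, T (x, z) ∂μ ∂P ≤ C * Real.exp 1 * Real.exp (-t) * N := by
    rw [integral_integral_swap hTi, ← integral_const_mul]
    refine integral_mono_ae hTi.integral_prod_right (hwi.abs.const_mul _)
      (htail.mono fun z hz => ?_)
    simp only [hT, integral_mul_const]
    refine mul_le_mul_of_nonneg_right ((hz (t - 1)).trans (le_of_eq ?_)) (abs_nonneg _)
    rw [mul_assoc, ← Real.exp_add]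
    congr 2
    ring
  have hsub : ∀ᵐ x ∂P, t * N ≤ |(∫ z, L x z * w z ∂μ) - ∫ z, m z * w z ∂μ| →
      N ≤ ∫ z, T (x, z) ∂μ := by
    filter_upwards [hx, hTi.prod_right_ae] with x hxL hxT hxt
    have hxw : Integrable (fun z => L x z * w z) μ :=
      hxL.mul_bdd (c := B) hw.aestronglyMeasurable (Filter.Eventually.of_forall hB)
    rw [← integral_sub hxw hmw] at hxt
    have h1 : t * N ≤ ∫ z, |L x z * w z - m z * w z| ∂μ := hxt.trans (abs_integral_le_integral_abs)
    have h2 : ∫ z, |L x z * w z - m z * w z| ∂μ ≤ ∫ z, (T (x, z) + (t - 1) * |w z|) ∂μ := by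
      refine integral_mono (hxw.sub hmw).abs (hxT.add (hwi.abs.const_mul _)) fun z => ?_
      change |L x z * w z - m z * w z| ≤ T (x, z) + (t - 1) * |w z|
      simp only [hT]
      rw [← sub_mul, abs_mul, ← add_mul]
      refine mul_le_mul_of_nonneg_right ?_ (abs_nonneg _)
      linarith [le_max_left (|L x z - m z| - (t - 1)) 0]
    rw [integral_add hxT (hwi.abs.const_mul _), integral_const_mul] at h2
    linarith
  have hmark := mul_meas_ge_le_integral_of_nonneg (μ := P)
    (f := fun x => ∫ z, T (x, z) ∂μ) (Filter.Eventually.of_forall fun x =>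
      integral_nonneg fun z => by simp only [hT]; positivity) hTi.integral_prod_left N
  have hle : P.real {x | t * N ≤ |(∫ z, L x z * w z ∂μ) - ∫ z, m z * w z ∂μ|} ≤
      P.real {x | N ≤ ∫ z, T (x, z) ∂μ} :=
    ENNReal.toReal_mono (measure_ne_top _ _) (measure_mono_ae hsub)
  refine hle.trans ?_
  refine le_of_mul_le_mul_left ?_ hN
  linarith

end

/-- A family of finite measures living on an open set `V` is measurable as soon as it is so when
tested against `C²` functions supported in `V`. -/
theorem measurable_measure_of_measurable_integral {Ω : Type*} [MeasurableSpace Ω]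
    {κ : Ω → Measure ℂ} [∀ x, IsFiniteMeasure (κ x)] {V : Set ℂ} (hV : IsOpen V)
    (hκ : ∀ x, κ x Vᶜ = 0)
    (h : ∀ φ : ℂ → ℝ, ContDiff ℝ 2 φ → Function.support φ ⊆ V → Measurable fun x => ∫ z, φ z ∂κ x) :
    Measurable κ := by
  have hopen : ∀ U : Set ℂ, IsOpen U → Measurable fun x => κ x U := by
    intro U hU
    obtain ⟨g, hgs, hgc, hgr⟩ := (hU.inter hV).exists_contDiff_support_eq (n := 2)
    have hgr' : ∀ z, g z ∈ Set.Icc (0 : ℝ) 1 := fun z => hgr ⟨z, rfl⟩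
    have heq : ∀ x, κ x U = ENNReal.ofReal (∫ z, (U ∩ V).indicator (fun _ => (1 : ℝ)) z ∂κ x) := by
      intro x
      rw [integral_indicator_const _ (hU.inter hV).measurableSet, smul_eq_mul, mul_one,
        ofReal_measureReal, ← measure_inter_add_sdiff U hV.measurableSet,
        measure_mono_null (t := Vᶜ) (s := U \ V) (fun z hz => hz.2) (hκ x), add_zero]
    simp_rw [heq]
    refine ENNReal.measurable_ofReal.comp ?_
    refine measurable_of_tendsto_metrizable
      (f := fun (k : ℕ) x => ∫ z, (1 - (1 - g z) ^ k) ∂κ x) (fun k => ?_) ?_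
    · refine h _ (by fun_prop) fun z hz => ?_
      have : g z ≠ 0 := by
        intro h0
        simp [h0] at hz
      have : z ∈ Function.support g := this
      rw [hgs] at this
      exact this.2
    · rw [tendsto_pi_nhds]
      intro x
      refine tendsto_integral_of_dominated_convergence (fun _ => 1)
        (fun k => (by fun_prop : Continuous fun z => 1 - (1 - g z) ^ k).aestronglyMeasurable)
        (integrable_const _) (fun k => Filter.Eventually.of_forall fun z => ?_)
        (Filter.Eventually.of_forall fun z => ?_)
      · have h1 := pow_nonneg (sub_nonneg.2 (hgr' z).2) k
        have h2 := pow_le_one₀ (n := k) (sub_nonneg.2 (hgr' z).2) (by linarith [(hgr' z).1])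
        rw [Real.norm_eq_abs, abs_le]
        constructor <;> linarith
      · by_cases hz : z ∈ U ∩ V
        · rw [Set.indicator_of_mem hz]
          rw [← hgs] at hz
          have hz0 : 0 < g z := lt_of_le_of_ne (hgr' z).1 (Ne.symm hz)
          simpa using (tendsto_pow_atTop_nhds_zero_of_lt_one (sub_nonneg.2 (hgr' z).2)
            (by linarith)).const_sub 1
        · rw [Set.indicator_of_notMem hz]
          rw [← hgs, Function.mem_support, not_not] at hz
          simp [hz]
  exact Measurable.measure_of_isPiSystem (S := {s : Set ℂ | IsOpen s})
    (BorelSpace.measurable_eq) isPiSystem_isOpen hopen (hopen _ isOpen_univ)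

theorem integral_eq_integral_integral_of_forall_apply {Ω Z : Type*} [MeasurableSpace Ω]
    [MeasurableSpace Z] {P : Measure Ω} {κ : Ω → Measure Z} (hκ : Measurable κ) {ρ : Measure Z}
    (hρ : ∀ U, MeasurableSet U → ρ U = ∫⁻ x, κ x U ∂P) {ψ : Z → ℝ} (hψ : Measurable ψ)
    (hi : ∀ x, Integrable ψ (κ x)) (hi' : Integrable (fun x => ∫ z, |ψ z| ∂κ x) P) :
    ∫ z, ψ z ∂ρ = ∫ x, (∫ z, ψ z ∂κ x) ∂P := by
  let η : ProbabilityTheory.Kernel Ω Z := ⟨κ, hκ⟩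
  have hη : ρ = (η.comp (ProbabilityTheory.Kernel.const Unit P)) () := by
    ext U hU
    rw [hρ U hU, ProbabilityTheory.Kernel.comp_apply' _ _ _ hU]
    simp [η]
  have hint : Integrable ψ ((η.comp (ProbabilityTheory.Kernel.const Unit P)) ()) := by
    rw [ProbabilityTheory.integrable_comp_iff hψ.aestronglyMeasurable]
    exact ⟨Filter.Eventually.of_forall hi, by simpa [η] using hi'⟩
  rw [hη, ProbabilityTheory.Kernel.integral_comp hint]
  simp [η]

/-- The uniform probability measure on `F`, on the subtype. -/
noncomputable def uniformOnSubtype {n : ℕ} (F : Set (EuclideanSpace ℝ (Fin n))) : Measure F :=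
  (volume F)⁻¹ • Measure.comap Subtype.val volume

theorem measurePreserving_uniformOnSubtype {n : ℕ} {F : Set (EuclideanSpace ℝ (Fin n))}
    (hF : MeasurableSet F) :
    MeasurePreserving (fun x : F => WithLp.ofLp x.1) (uniformOnSubtype F)
      (ProbabilityTheory.cond volume (WithLp.toLp 2 ⁻¹' F)) := by
  have he := EuclideanSpace.volume_preserving_symm_measurableEquiv_toLp (Fin n)
  have hpre : WithLp.ofLp ⁻¹' ((WithLp.toLp 2 : (Fin n → ℝ) → _) ⁻¹' F) = F := rfl
  have hF' : MeasurableSet ((WithLp.toLp 2 : (Fin n → ℝ) → _) ⁻¹' F) :=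
    hF.preimage (by fun_prop)
  have hvol : volume F = volume ((WithLp.toLp 2 : (Fin n → ℝ) → _) ⁻¹' F) := by
    rw [← he.measure_preimage hF'.nullMeasurableSet]
    rfl
  have h1 := he.restrict_preimage hF'
  have h2 : MeasurePreserving (Subtype.val : F → _) (Measure.comap Subtype.val volume)
    (volume.restrict F) := ⟨measurable_subtype_coe, map_comap_subtype_coe hF _⟩
  have h3 := (MeasurePreserving.comp h1 h2)
  refine ⟨h3.measurable, ?_⟩
  rw [uniformOnSubtype, Measure.map_smul, ProbabilityTheory.cond, hvol]
  congr 1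
  exact h3.map_eq

theorem isProbabilityMeasure_uniformOnSubtype {n : ℕ} {F : Set (EuclideanSpace ℝ (Fin n))}
    (hF : IsCompact F) (hF0 : 0 < volume F) : IsProbabilityMeasure (uniformOnSubtype F) := by
  refine ⟨?_⟩
  rw [uniformOnSubtype, Measure.smul_apply, comap_subtype_coe_apply hF.measurableSet]
  simpa using ENNReal.inv_mul_cancel hF0.ne' hF.measure_ne_top

theorem integrable_log_norm_uniformOnSubtype {n d : ℕ} (hd : 1 ≤ d)
    {F : Set (EuclideanSpace ℝ (Fin n))} (hF : IsCompact F) (hFc : Convex ℝ F)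
    (hF0 : 0 < volume F) (P : MvPolynomial (Fin n) ℂ) (hP : P.totalDegree ≤ d)
    {x₀ : EuclideanSpace ℝ (Fin n)} (hx₀ : x₀ ∈ F)
    (hPx : MvPolynomial.eval (fun i => ((x₀ i : ℝ) : ℂ)) P ≠ 0) :
    Integrable (fun x : F => Real.log ‖MvPolynomial.eval (fun i => ((x.1 i : ℝ) : ℂ)) P‖ / d)
      (uniformOnSubtype F) ∧
    ∀ a, ∫ x : F, max (|Real.log ‖MvPolynomial.eval (fun i => ((x.1 i : ℝ) : ℂ)) P‖ / d -
        ∫ y : F, Real.log ‖MvPolynomial.eval (fun i => ((y.1 i : ℝ) : ℂ)) P‖ / d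
          ∂uniformOnSubtype F| - a) 0 ∂uniformOnSubtype F ≤ 8 * Real.exp 1 * Real.exp (-a) := by
  have hΦ := measurePreserving_uniformOnSubtype hF.measurableSet
  set F' : Set (Fin n → ℝ) := WithLp.toLp 2 ⁻¹' F with hF'
  have hF'c : IsCompact F' :=
    (PiLp.homeomorph 2 (fun _ : Fin n => ℝ)).symm.isCompact_preimage.2 hF
  have hF'conv : Convex ℝ F' :=
    hFc.linear_preimage (WithLp.linearEquiv 2 ℝ (Fin n → ℝ)).symm.toLinearMap
  have hF'0 : volume F' ≠ 0 := by
    have he := EuclideanSpace.volume_preserving_symm_measurableEquiv_toLp (Fin n)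
    rw [← he.measure_preimage hF'c.measurableSet.nullMeasurableSet]
    exact hF0.ne'
  obtain ⟨h1, h2⟩ := integrable_log_norm_eval_and_integral_le hd hF'c hF'conv hF'0 P hP
    (x₀ := WithLp.ofLp x₀) hx₀ hPx
  have hmeas : Measurable fun x : Fin n → ℝ =>
      Real.log ‖MvPolynomial.eval (fun i => ((x i : ℝ) : ℂ)) P‖ / d :=
    (Real.measurable_log.comp (continuous_eval_ofReal P).norm.measurable).div_const _
  have hE : ∫ y : F, Real.log ‖MvPolynomial.eval (fun i => ((y.1 i : ℝ) : ℂ)) P‖ / d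
      ∂uniformOnSubtype F = ∫ y, Real.log ‖MvPolynomial.eval (fun i => ((y i : ℝ) : ℂ)) P‖ / d
        ∂ProbabilityTheory.cond volume F' := by
    rw [← hΦ.map_eq, integral_map hΦ.measurable.aemeasurable hmeas.aestronglyMeasurable]
  refine ⟨hΦ.integrable_comp_of_integrable h1, fun a => ?_⟩
  rw [hE]
  have h3 := h2 a
  generalize (∫ y, Real.log ‖MvPolynomial.eval (fun i => ((y i : ℝ) : ℂ)) P‖ / d
    ∂ProbabilityTheory.cond volume F') = c at h3 ⊢
  rwa [← hΦ.map_eq, integral_map hΦ.measurable.aemeasurable] at h3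
  exact ((((hmeas.sub_const _).abs).sub_const _).max measurable_const).aestronglyMeasurable

/-- A measure counting zeros of `g` acts on smooth functions through `log ‖g‖`. -/
theorem HasZeroOrderOn.isFiniteMeasure_and_integral_eq {g : ℂ → ℂ} {m : ℂ → ℕ} {G K : Set ℂ}
    (h : HasZeroOrderOn g m G) (hK : IsCompact K) (hKG : K ⊆ G) {ρ : Measure ℂ}
    (hρ : ∀ U : Set ℂ, MeasurableSet U → ρ U = ∑' w : ↥(U ∩ G), (m ↑w : ENNReal)) :
    volume {z | z ∈ K ∧ g z = 0} = 0 ∧ IntegrableOn (fun z => Real.log ‖g z‖) K ∧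
    IsFiniteMeasure (ρ.restrict K) ∧
    ∀ φ : ℂ → ℝ, ContDiff ℝ 2 φ → tsupport φ ⊆ K →
      ∫ z, φ z ∂ρ = (2 * Real.pi)⁻¹ * ∫ z in K, Real.log ‖g z‖ * planarLaplacian φ z := by
  have hgK : HasZeroOrderOn g m K := fun w hw => h w (hKG hw)
  obtain ⟨hint, S, hSK, hS0, hS⟩ := hgK.exists_finset_integral_log_norm hK
  have hres : ρ.restrict K = ∑ w ∈ S, (m w : ENNReal) • Measure.dirac w := by
    ext U hU
    rw [Measure.restrict_apply hU, hρ _ (hU.inter hK.measurableSet), Measure.finsetSum_apply,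
      tsum_subtype (U ∩ K ∩ G) (fun w => (m w : ENNReal)), tsum_eq_sum (s := S)]
    · refine Finset.sum_congr rfl fun w hw => ?_
      have hwK : w ∈ K := hSK hw
      rw [Measure.smul_apply, Measure.dirac_apply' _ hU, smul_eq_mul]
      by_cases hwU : w ∈ U
      · rw [Set.indicator_of_mem (show w ∈ U ∩ K ∩ G from ⟨⟨hwU, hwK⟩, hKG hwK⟩),
          Set.indicator_of_mem hwU]
        simp
      · rw [Set.indicator_of_notMem (show w ∉ U ∩ K ∩ G from fun hh => hwU hh.1.1),
          Set.indicator_of_notMem hwU, mul_zero]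
    · intro w hw
      by_cases hwK : w ∈ U ∩ K ∩ G
      · rw [Set.indicator_of_mem hwK, hS0 w hwK.1.2 hw, Nat.cast_zero]
      · rw [Set.indicator_of_notMem hwK]
  refine ⟨?_, hint, ?_, fun φ hφ hφK => ?_⟩
  · refine measure_mono_null (fun z hz => ?_) (S.countable_toSet.measure_zero volume)
    by_contra hzS
    obtain ⟨q, -, hq0, hq⟩ := hgK z hz.1
    have := hq.self_of_nhds
    rw [hz.2, hS0 z hz.1 hzS, pow_zero, one_mul] at this
    exact hq0 this.symm
  · refine ⟨?_⟩
    rw [hres, Measure.finsetSum_apply]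
    refine ENNReal.sum_lt_top.2 fun w _ => ?_
    simp
  · have h1 : ∫ z in K, φ z ∂ρ = ∫ z, φ z ∂ρ :=
      setIntegral_eq_integral_of_forall_compl_eq_zero fun z hz =>
        image_eq_zero_of_notMem_tsupport fun hz' => hz (hφK hz')
    have h2 : ∫ z in K, Real.log ‖g z‖ * planarLaplacian φ z =
        ∫ z, Real.log ‖g z‖ * planarLaplacian φ z :=
      setIntegral_eq_integral_of_forall_compl_eq_zero fun z hz => by
        rw [image_eq_zero_of_notMem_tsupport fun hz' =>
          hz (hφK (tsupport_planarLaplacian_subset φ hz')), mul_zero]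
    rw [h2, hS φ hφ hφK, ← h1, hres, integral_finsetSum_measure]
    · rw [← mul_assoc, inv_mul_cancel₀ (by positivity), one_mul]
      refine Finset.sum_congr rfl fun w _ => ?_
      rw [integral_smul_measure, integral_dirac]
      simp
    · intro w _
      exact (integrable_dirac (by simp [enorm_lt_top])).smul_measure (by simp)

section

variable {Ω : Type*} [MeasurableSpace Ω] {P : Measure Ω}
  {f : Ω → ℂ → ℂ} {d : ℕ} {K : Set ℂ} {κ : Ω → Measure ℂ} {ρ : Measure ℂ} {C : ℝ}

theorem exists_forall_abs_planarLaplacian_le {φ : ℂ → ℝ} (hφ : ContDiff ℝ 2 φ)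
    (hφc : HasCompactSupport φ) : ∃ B, ∀ z, |planarLaplacian φ z| ≤ B :=
  hφc.planarLaplacian.exists_bound_of_continuous (continuous_planarLaplacian hφ)

/-- The average of the measures `κ x` integrates `C²` functions supported inside `K` as expected. -/
theorem integral_average_eq_integral_integral (hK : IsCompact K)
    (hfin : ∀ x, IsFiniteMeasure ((κ x).restrict K))
    (hφi : ∀ φ : ℂ → ℝ, ContDiff ℝ 2 φ → tsupport φ ⊆ K → Integrable (fun x => ∫ z, φ z ∂κ x) P)
    (hφm : ∀ φ : ℂ → ℝ, ContDiff ℝ 2 φ → tsupport φ ⊆ K → Measurable fun x => ∫ z, φ z ∂κ x)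
    (hρ : ∀ U, MeasurableSet U → ρ U = ∫⁻ x, κ x U ∂P)
    {ψ : ℂ → ℝ} (hψ : ContDiff ℝ 2 ψ) (hψK : tsupport ψ ⊆ interior K) :
    ∫ z, ψ z ∂ρ = ∫ x, (∫ z, ψ z ∂κ x) ∂P := by
  have hVm : MeasurableSet (interior K) := isOpen_interior.measurableSet
  have hsupp : ∀ φ : ℂ → ℝ, Function.support φ ⊆ interior K → tsupport φ ⊆ K := fun φ hφ =>
    closure_minimal (hφ.trans interior_subset) hK.isClosed
  have hVφ : ∀ (φ : ℂ → ℝ) (τ : Measure ℂ), Function.support φ ⊆ interior K →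
      ∫ z in interior K, φ z ∂τ = ∫ z, φ z ∂τ := fun φ τ hφ =>
    setIntegral_eq_integral_of_forall_compl_eq_zero fun z hz => by
      by_contra h0
      exact hz (hφ h0)
  have hfin' : ∀ x, IsFiniteMeasure ((κ x).restrict (interior K)) := fun x =>
    ⟨by
      have := (hfin x).measure_univ_lt_top
      rw [Measure.restrict_apply_univ] at this ⊢
      exact (measure_mono interior_subset).trans_lt this⟩
  have hκ : Measurable fun x => (κ x).restrict (interior K) := by
    refine measurable_measure_of_measurable_integral (V := interior K) isOpen_interior (fun x => ?_)
      fun φ hφ hφV => ?_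
    · rw [Measure.restrict_apply hVm.compl, Set.compl_inter_self, measure_empty]
    · simp_rw [hVφ φ _ hφV]
      exact hφm φ hφ (hsupp φ hφV)
  have hψc : HasCompactSupport ψ :=
    HasCompactSupport.of_support_subset_isCompact hK
      ((subset_tsupport ψ).trans (hψK.trans interior_subset))
  obtain ⟨B, hB⟩ := hψc.exists_bound_of_continuous hψ.continuous
  have hB0 : 0 ≤ B := (norm_nonneg _).trans (hB 0)
  have hψV : Function.support ψ ⊆ interior K := (subset_tsupport ψ).trans hψK
  obtain ⟨χ, hχ, hχr, hχs, hχ1⟩ := exists_contMDiff_support_eq_eq_one_iff (n := 2)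
    (modelWithCornersSelf ℝ ℂ) isOpen_interior (isClosed_tsupport ψ) hψK
  have hχ2 : ContDiff ℝ 2 χ := contMDiff_iff_contDiff.1 hχ
  have hχr' : ∀ z, χ z ∈ Set.Icc (0 : ℝ) 1 := fun z => hχr ⟨z, rfl⟩
  have hi : ∀ x, Integrable ψ ((κ x).restrict (interior K)) := fun x =>
    Integrable.mono' (integrable_const B) hψ.continuous.aestronglyMeasurable
      (Filter.Eventually.of_forall hB)
  have hχi : ∀ x, Integrable χ ((κ x).restrict (interior K)) := fun x =>
    Integrable.mono' (integrable_const 1) hχ2.continuous.aestronglyMeasurable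
      (Filter.Eventually.of_forall fun z => by
        rw [Real.norm_of_nonneg (hχr' z).1]
        exact (hχr' z).2)
  have hdom : ∀ z, |ψ z| ≤ B * χ z := by
    intro z
    by_cases hz : z ∈ tsupport ψ
    · rw [(hχ1 z).1 hz, mul_one]
      exact hB z
    · rw [image_eq_zero_of_notMem_tsupport hz, abs_zero]
      exact mul_nonneg hB0 (hχr' z).1
  have hmain := integral_eq_integral_integral_of_forall_apply (P := P) hκ
    (ρ := ρ.restrict (interior K)) (fun U hU => ?_) hψ.continuous.measurable hi ?_
  · simp_rw [hVφ ψ _ hψV] at hmain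
    exact hmain
  · simp_rw [Measure.restrict_apply hU]
    exact hρ _ (hU.inter hVm)
  · have hχP := hφi χ hχ2 (hsupp χ hχs.subset)
    refine Integrable.mono' (hχP.const_mul B) ?_ (Filter.Eventually.of_forall fun x => ?_)
    · exact (StronglyMeasurable.integral_kernel (κ := ⟨_, hκ⟩)
        hψ.continuous.abs.stronglyMeasurable).aestronglyMeasurable
    · rw [Real.norm_of_nonneg (integral_nonneg fun _ => abs_nonneg _), ← hVφ χ _ hχs.subset,
        ← integral_const_mul]
      exact integral_mono (hi x).abs ((hχi x).const_mul B) hdom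

theorem measureReal_linear_statistic_deviation_le [IsProbabilityMeasure P] (hd : 1 ≤ d)
    (hK : IsCompact K)
    (hfm : Measurable (Function.uncurry fun x => K.indicator (f x)))
    (htail : ∀ᵐ z ∂volume.restrict K, Integrable (fun x => Real.log ‖f x z‖ / d) P ∧
      ∀ a, ∫ x, max (|Real.log ‖f x z‖ / d - ∫ y, Real.log ‖f y z‖ / d ∂P| - a) 0 ∂P ≤
        C * Real.exp (-a))
    (hx : ∀ x, IntegrableOn (fun z => Real.log ‖f x z‖) K)
    (hfin : ∀ x, IsFiniteMeasure ((κ x).restrict K))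
    (hκ : ∀ x (φ : ℂ → ℝ), ContDiff ℝ 2 φ → tsupport φ ⊆ K →
      ∫ z, φ z ∂κ x = (2 * Real.pi)⁻¹ * ∫ z in K, Real.log ‖f x z‖ * planarLaplacian φ z)
    (hρ : ∀ U, MeasurableSet U → ρ U = ∫⁻ x, κ x U ∂P)
    {ψ : ℂ → ℝ} (hψ : ContDiff ℝ 2 ψ) (hψK : tsupport ψ ⊆ interior K)
    (hN : 0 < ∫ z in K, |planarLaplacian ψ z|) (lam : ℝ) :
    P.real {x | lam ≤ |(∫ z, ψ z ∂κ x) - ∫ z, ψ z ∂ρ|} ≤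
      C * Real.exp 1 *
        Real.exp (-(2 * Real.pi * lam) / (d * ∫ z in K, |planarLaplacian ψ z|)) := by
  have hd0 : (0 : ℝ) < d := by exact_mod_cast hd
  have hfinK : IsFiniteMeasure (volume.restrict K) := ⟨by
    rw [Measure.restrict_apply_univ]
    exact hK.measure_lt_top⟩
  set L : Ω → ℂ → ℝ := fun x z => Real.log ‖K.indicator (f x) z‖ / d with hL
  have hLK : ∀ x, ∀ z ∈ K, L x z = Real.log ‖f x z‖ / d := fun x z hz => by
    simp only [hL, Set.indicator_of_mem hz]
  have hLm : Measurable (Function.uncurry L) := (Real.measurable_log.comp hfm.norm).div_const _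
  have hLtail : ∀ᵐ z ∂volume.restrict K, Integrable (fun x => L x z) P ∧
      ∀ a, ∫ x, max (|L x z - ∫ y, L y z ∂P| - a) 0 ∂P ≤ C * Real.exp (-a) := by
    filter_upwards [htail, ae_restrict_mem hK.measurableSet] with z hz hzK
    simpa only [hLK _ z hzK] using hz
  have hLx : ∀ x, Integrable (L x) (volume.restrict K) := fun x =>
    (integrableOn_congr_fun (fun z hz => hLK x z hz) hK.measurableSet).2 ((hx x).div_const _)
  have h0 : ∀ t : ℝ, max |t| 0 = |t| := fun t => max_eq_left (abs_nonneg t)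
  obtain ⟨hLi, -⟩ := integrable_uncurry_of_integral_abs_sub_le hLm (hLtail.mono fun z hz => hz.1)
    (hLtail.mono fun z hz => by simpa [h0] using hz.2 0) (Filter.Eventually.of_forall hLx)
  have hκL : ∀ x (φ : ℂ → ℝ), ContDiff ℝ 2 φ → tsupport φ ⊆ K →
      ∫ z, φ z ∂κ x = d / (2 * Real.pi) * ∫ z in K, L x z * planarLaplacian φ z := by
    intro x φ hφ hφK
    have hL' : ∫ z in K, L x z * planarLaplacian φ z =
        (d : ℝ)⁻¹ * ∫ z in K, Real.log ‖f x z‖ * planarLaplacian φ z := by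
      rw [← integral_const_mul]
      refine setIntegral_congr_fun hK.measurableSet fun z hz => ?_
      simp only [hLK x z hz]
      ring
    rw [hκ x φ hφ hφK, hL']
    field_simp
  have hcs : ∀ φ : ℂ → ℝ, tsupport φ ⊆ K → HasCompactSupport φ := fun φ hφ =>
    HasCompactSupport.of_support_subset_isCompact hK ((subset_tsupport φ).trans hφ)
  have hφi : ∀ φ : ℂ → ℝ, ContDiff ℝ 2 φ → tsupport φ ⊆ K →
      Integrable (fun x => ∫ z, φ z ∂κ x) P := by
    intro φ hφ hφK
    obtain ⟨B, hB⟩ := exists_forall_abs_planarLaplacian_le hφ (hcs φ hφK)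
    simp_rw [hκL _ φ hφ hφK]
    refine Integrable.const_mul ?_ _
    exact (hLi.mul_bdd (c := B) (g := fun p => planarLaplacian φ p.2)
      ((continuous_planarLaplacian hφ).measurable.comp measurable_snd).aestronglyMeasurable
      (Filter.Eventually.of_forall fun p => hB _)).integral_prod_left
  have hφm : ∀ φ : ℂ → ℝ, ContDiff ℝ 2 φ → tsupport φ ⊆ K →
      Measurable fun x => ∫ z, φ z ∂κ x := by
    intro φ hφ hφK
    simp_rw [hκL _ φ hφ hφK]
    refine Measurable.const_mul ?_ _
    exact ((hLm.mul ((continuous_planarLaplacian hφ).measurable.comp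
      measurable_snd)).stronglyMeasurable.integral_prod_right').measurable
  have hψK' := hψK.trans interior_subset
  have hρψ := integral_average_eq_integral_integral hK hfin hφi hφm hρ hψ hψK
  obtain ⟨B, hB⟩ := exists_forall_abs_planarLaplacian_le hψ (hcs ψ hψK')
  set N := ∫ z in K, |planarLaplacian ψ z| with hNdef
  have hmain := (measureReal_weighted_integral_deviation_le hLm (hLtail.mono fun z hz => hz.1)
    (hLtail.mono fun z hz => hz.2) (Filter.Eventually.of_forall hLx)
    (continuous_planarLaplacian hψ).measurable hB hN (2 * Real.pi * lam / (d * N))).2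
  rw [← neg_div] at hmain
  refine le_trans (le_of_eq ?_) hmain
  congr 1
  ext x
  rw [hρψ]
  simp_rw [hκL _ ψ hψ hψK', integral_const_mul]
  rw [← hNdef]
  have h1 : 2 * Real.pi * lam / (d * N) * N = lam / (d / (2 * Real.pi)) := by
    field_simp
  change lam ≤ |_| ↔ 2 * Real.pi * lam / (d * N) * N ≤ |_|
  rw [h1, ← mul_sub, abs_mul, abs_of_pos (by positivity : 0 < d / (2 * Real.pi)),
    div_le_iff₀' (by positivity)]

end

/-- Offord's estimate: if `f(x;z)` is analytic in `z ∈ G` and polynomial of degree at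
most `d` in the parameter `x` ranging over a compact convex set `F ⊂ ℝⁿ`, `ν_x` is the
counting measure of zeroes of `f(x;·)` in `G`, and `ν` its average over `F`, then for
every test function `ψ ∈ C_0^∞(G)` and every `λ > 0`,
`Vol{x ∈ F : |∫ψ dν_x - ∫ψ dν| ≥ λ}/Vol(F) ≤ 8e²·exp(-2πλ/(d‖Δψ‖_{L¹(G)}))`. -/
theorem offord_estimate {n : ℕ} (d : ℕ)
    (F : Set (EuclideanSpace ℝ (Fin n))) (hFcomp : IsCompact F) (hFconv : Convex ℝ F)
    (hFvol : 0 < volume F)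
    (G : Set ℂ) (hGopen : IsOpen G) (hGconn : IsConnected G)
    (f : EuclideanSpace ℝ (Fin n) → ℂ → ℂ)
    (hfan : ∀ x ∈ F, DifferentiableOn ℂ (f x) G)
    (hfnz : ∀ x ∈ F, ∃ z ∈ G, f x z ≠ 0)
    (hfpoly : ∀ z ∈ G, ∃ Q : MvPolynomial (Fin n) ℂ, Q.totalDegree ≤ d ∧
      ∀ x ∈ F, f x z = MvPolynomial.eval (fun i => ((x i : ℝ) : ℂ)) Q)
    (νx : EuclideanSpace ℝ (Fin n) → Measure ℂ)
    (hνx : ∀ x ∈ F, ∃ m : ℂ → ℕ,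
      (∀ w ∈ G, ∃ g : ℂ → ℂ, AnalyticAt ℂ g w ∧ g w ≠ 0 ∧
        ∀ᶠ z in nhds w, f x z = (z - w) ^ m w * g z) ∧
      ∀ U : Set ℂ, MeasurableSet U → νx x U = ∑' w : ↥(U ∩ G), (m ↑w : ENNReal))
    (ν : Measure ℂ)
    (hν : ∀ U : Set ℂ, MeasurableSet U → ν U = (volume F)⁻¹ * ∫⁻ x in F, νx x U)
    (ψ : ℂ → ℝ) (hψsmooth : ContDiff ℝ (⊤ : ℕ∞) ψ) (hψcomp : HasCompactSupport ψ)
    (hψsupp : tsupport ψ ⊆ G)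
    (lam : ℝ) (hlam : 0 < lam) :
    (volume {x ∈ F |
        lam ≤ |(∫ z in G, ψ z ∂(νx x)) - ∫ z in G, ψ z ∂ν|}).toReal /
      (volume F).toReal ≤
      8 * Real.exp 2 *
        Real.exp (-(2 * Real.pi * lam) / (d * ∫ z in G, |planarLaplacian ψ z|)) := by
  have hP := isProbabilityMeasure_uniformOnSubtype hFcomp hFvol
  have hFne : (volume F).toReal ≠ 0 :=
    (ENNReal.toReal_pos hFvol.ne' hFcomp.measure_ne_top).ne'
  set s : Set (EuclideanSpace ℝ (Fin n)) := {x ∈ F |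
    lam ≤ |(∫ z in G, ψ z ∂(νx x)) - ∫ z in G, ψ z ∂ν|} with hs
  have hle1 : (volume s).toReal / (volume F).toReal ≤ 1 :=
    div_le_one_of_le₀ (ENNReal.toReal_mono hFcomp.measure_ne_top (measure_mono fun x hx => hx.1))
      ENNReal.toReal_nonneg
  have hψ2 : ContDiff ℝ 2 ψ := contDiff_infty.1 hψsmooth 2
  by_cases hdeg : (d : ℝ) * ∫ z in G, |planarLaplacian ψ z| = 0
  · rw [hdeg, div_zero, Real.exp_zero, mul_one]
    linarith [Real.one_le_exp (by norm_num : (0 : ℝ) ≤ 2)]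
  have hd : 1 ≤ d := Nat.one_le_iff_ne_zero.2 fun h => hdeg (by simp [h])
  obtain ⟨K, hK, hψK, hKG⟩ := exists_compact_between hψcomp hGopen hψsupp
  have hGψ : ∀ τ : Measure ℂ, ∫ z in G, ψ z ∂τ = ∫ z, ψ z ∂τ := fun τ =>
    setIntegral_eq_integral_of_forall_compl_eq_zero fun z hz =>
      image_eq_zero_of_notMem_tsupport fun hz' => hz (hψsupp hz')
  have hΔ : ∀ T : Set ℂ, tsupport ψ ⊆ T →
      ∫ z in T, |planarLaplacian ψ z| = ∫ z, |planarLaplacian ψ z| := fun T hT =>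
    setIntegral_eq_integral_of_forall_compl_eq_zero fun z hz => by
      rw [image_eq_zero_of_notMem_tsupport fun hz' =>
        hz (hT (tsupport_planarLaplacian_subset ψ hz')), abs_zero]
  have hGK : ∫ z in G, |planarLaplacian ψ z| = ∫ z in K, |planarLaplacian ψ z| := by
    rw [hΔ G hψsupp, hΔ K (hψK.trans interior_subset)]
  rw [hGK] at hdeg ⊢
  have hN : 0 < ∫ z in K, |planarLaplacian ψ z| :=
    lt_of_le_of_ne (integral_nonneg fun _ => abs_nonneg _)
      (Ne.symm (right_ne_zero_of_mul hdeg))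
  have hzero : ∀ x : F, volume {z | z ∈ K ∧ f x z = 0} = 0 ∧
      IntegrableOn (fun z => Real.log ‖f x z‖) K ∧ IsFiniteMeasure ((νx x).restrict K) ∧
      ∀ φ : ℂ → ℝ, ContDiff ℝ 2 φ → tsupport φ ⊆ K → ∫ z, φ z ∂(νx x) =
        (2 * Real.pi)⁻¹ * ∫ z in K, Real.log ‖f x z‖ * planarLaplacian φ z := by
    intro x
    obtain ⟨m, hm, hU⟩ := hνx x x.2
    exact HasZeroOrderOn.isFiniteMeasure_and_integral_eq hm hK hKG hU
  obtain ⟨x₀, hx₀⟩ := nonempty_of_measure_ne_zero hFvol.ne'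
  have hfm : Measurable (Function.uncurry fun x : F => K.indicator (f x)) := by
    refine measurable_uncurry_of_continuous_of_measurable (fun z => ?_) fun x => ?_
    · by_cases hz : z ∈ K
      · obtain ⟨Q, -, hQ⟩ := hfpoly z (hKG hz)
        have : (fun x : F => K.indicator (f x) z) =
            fun x : F => MvPolynomial.eval (fun i => ((x.1 i : ℝ) : ℂ)) Q := by
          funext x
          rw [Set.indicator_of_mem hz, hQ x x.2]
        rw [this]
        exact (continuous_eval_ofReal Q).comp (by fun_prop : Continuous fun x : F => x.1.ofLp)
      · simp only [Set.indicator_of_notMem hz]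
        exact continuous_const
    · classical
      rw [← Set.piecewise_eq_indicator]
      exact ((hfan x x.2).continuousOn.mono hKG).measurable_piecewise continuousOn_const
        hK.measurableSet
  have htail : ∀ᵐ z ∂volume.restrict K,
      Integrable (fun x : F => Real.log ‖f x z‖ / d) (uniformOnSubtype F) ∧
      ∀ a, ∫ x : F, max (|Real.log ‖f x z‖ / d -
        ∫ y : F, Real.log ‖f y z‖ / d ∂uniformOnSubtype F| - a) 0 ∂uniformOnSubtype F ≤
        8 * Real.exp 1 * Real.exp (-a) := by
    have hae : ∀ᵐ z ∂volume, ¬ (z ∈ K ∧ f x₀ z = 0) :=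
      measure_eq_zero_iff_ae_notMem.1 (hzero ⟨x₀, hx₀⟩).1
    filter_upwards [ae_restrict_of_ae hae, ae_restrict_mem hK.measurableSet] with z hz hzK
    obtain ⟨Q, hQd, hQ⟩ := hfpoly z (hKG hzK)
    have hQF : ∀ x : F, f x z = MvPolynomial.eval (fun i => ((x.1 i : ℝ) : ℂ)) Q := fun x =>
      hQ x x.2
    simp_rw [hQF]
    refine integrable_log_norm_uniformOnSubtype hd hFcomp hFconv hFvol Q hQd hx₀ ?_
    rw [← hQ x₀ hx₀]
    exact fun h0 => hz ⟨hzK, h0⟩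
  have hρ : ∀ U, MeasurableSet U → ν U = ∫⁻ x : F, νx x U ∂uniformOnSubtype F := by
    intro U hU
    rw [hν U hU, uniformOnSubtype, lintegral_smul_measure, smul_eq_mul,
      lintegral_subtype_comap hFcomp.measurableSet fun x => νx x U]
  have hmain := measureReal_linear_statistic_deviation_le (P := uniformOnSubtype F)
    (f := fun x : F => f x) (κ := fun x : F => νx x) hd hK hfm htail (fun x => (hzero x).2.1)
    (fun x => (hzero x).2.2.1) (fun x => (hzero x).2.2.2) hρ hψ2 hψK hN lam
  have hexp : 8 * Real.exp 1 * Real.exp 1 = 8 * Real.exp 2 := by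
    rw [mul_assoc, ← Real.exp_add]
    norm_num
  rw [hexp] at hmain
  refine le_trans (le_of_eq ?_) hmain
  have himage : Subtype.val '' {x : F | lam ≤ |(∫ z, ψ z ∂(νx x)) - ∫ z, ψ z ∂ν|} = s := by
    ext x
    simp [hs, hGψ, and_comm]
  rw [measureReal_def, uniformOnSubtype, Measure.smul_apply,
    comap_subtype_coe_apply hFcomp.measurableSet, himage, smul_eq_mul, ENNReal.toReal_mul,
    ENNReal.toReal_inv, div_eq_inv_mul]
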